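/- arXiv:2010.06031 — 2 statements merged into one kernel-verified Lean document; each statement's English description precedes it below -/
import Mathlib

section
/- Let S ⊆ ℕ₀ be a nonempty set and let λ ∈ (0,1] be the unique positive solution of the equation Σ_{s∈S} x^{s+1} = 1. Then the topological entropy of the S-gap shift X(S) equals log(1/λ). -/
open Filter Topology

/-- The shift map on bi-infinite sequences over the alphabet `A`. -/
def shiftMap {A : Type*} (x : ℤ → A) : ℤ → A := fun i => x (i + 1)

/-- A finite word `w` appears (as a consecutive subsequence) in the bi-infinite
sequence `x`. -/
def Appears {A : Type*} (w : List A) (x : ℤ → A) : Prop :=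
  ∃ k : ℤ, ∀ i : Fin w.length, x (k + (i : ℕ)) = w.get i

/-- `w` belongs to the language of `X`: it appears in some point of `X`. -/
def InLanguage {A : Type*} (X : Set (ℤ → A)) (w : List A) : Prop :=
  ∃ x ∈ X, Appears w x

/-- `X` has topological entropy `h`, i.e. `(1/n) · log |B_n(X)| → h`. -/
def HasEntropy {A : Type*} (X : Set (ℤ → A)) (h : ℝ) : Prop :=
  Filter.Tendsto
    (fun n : ℕ => Real.log ({w : List A | w.length = n ∧ InLanguage X w}.ncard) / n)
    Filter.atTop (nhds h)

/-- The set of bi-infinite concatenations `⋯ u₋₁^{n₋₁} u₀^{n₀} u₁^{n₁} ⋯` with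
`uᵢ ∈ V`, `nᵢ ∈ S uᵢ` and `(uᵢ, uᵢ₊₁)` an edge of the graph.  The `S`-graph shift
`X(G,S)` is the closure of this set. -/
def SGraphCore {V : Type*} (Adj : V → V → Prop) (S : V → Set ℕ) : Set (ℤ → V) :=
  {x | ∃ (a : ℤ → V) (t : ℤ → ℤ), StrictMono t ∧
    (∀ i : ℤ, (t (i + 1) - t i).toNat ∈ S (a i)) ∧
    (∀ i : ℤ, Adj (a i) (a (i + 1))) ∧
    (∀ i k : ℤ, t i ≤ k → k < t (i + 1) → x k = a i) ∧
    (∀ m : ℤ, ∃ i : ℤ, t i ≤ m ∧ m < t (i + 1))}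

/-- The core of the `S`-gap shift: bi-infinite sequences of the form
`⋯ 1 0^{s₋₁} 1 0^{s₀} 1 0^{s₁} 1 ⋯` with every `sᵢ ∈ S`.  Here `t` enumerates the
positions of the `1`s. -/
def SGapCore (S : Set ℕ) : Set (ℤ → Fin 2) :=
  {x | ∃ t : ℤ → ℤ, StrictMono t ∧
    (∀ i : ℤ, x (t i) = 1) ∧
    (∀ i k : ℤ, t i < k → k < t (i + 1) → x k = 0) ∧
    (∀ i : ℤ, (t (i + 1) - t i - 1).toNat ∈ S) ∧
    (∀ m : ℤ, ∃ i : ℤ, t i ≤ m ∧ m < t (i + 1))}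

/-- The `S`-gap shift `X(S)`: the closure of `SGapCore S`. -/
noncomputable def SGapShift (S : Set ℕ) : Set (ℤ → Fin 2) := closure (SGapCore S)

/-- The block `1 0^s`. -/
def gapBlock (s : ℕ) : List (Fin 2) := 1 :: List.replicate s 0

/-- Finite concatenations of blocks `1 0^s` with `s ∈ S`. -/
inductive IsGapConcat (S : Set ℕ) : List (Fin 2) → Prop
  | nil : IsGapConcat S []
  | cons {s : ℕ} {w : List (Fin 2)} : s ∈ S → IsGapConcat S w → IsGapConcat S (gapBlock s ++ w)

/-- The word of length `n` read in `x` from position `k` on. -/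
def window {A : Type*} (x : ℤ → A) (k : ℤ) (n : ℕ) : List A :=
  (List.range n).map fun i => x (k + (i : ℕ))

@[simp]
theorem length_window {A : Type*} (x : ℤ → A) (k : ℤ) (n : ℕ) : (window x k n).length = n := by
  simp [window]

@[simp]
theorem window_zero {A : Type*} (x : ℤ → A) (k : ℤ) : window x k 0 = [] := by
  simp [window]

theorem window_add {A : Type*} (x : ℤ → A) (k : ℤ) (m n : ℕ) :
    window x k (m + n) = window x k m ++ window x (k + m) n := by
  simp only [window, List.range_add, List.map_append, List.map_map]
  congr 1
  apply List.map_congr_left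
  intro i _
  simp [add_assoc]

theorem window_succ {A : Type*} (x : ℤ → A) (k : ℤ) (n : ℕ) :
    window x k (n + 1) = x k :: window x (k + 1) n := by
  rw [add_comm, window_add]
  simp [window]

theorem window_congr {A : Type*} {x y : ℤ → A} {k l : ℤ} {n : ℕ}
    (h : ∀ i < n, x (k + (i : ℕ)) = y (l + (i : ℕ))) : window x k n = window y l n :=
  List.map_congr_left fun i hi => h i (List.mem_range.1 hi)

theorem window_eq_replicate {A : Type*} {x : ℤ → A} {k : ℤ} {n : ℕ} {a : A}
    (h : ∀ i < n, x (k + (i : ℕ)) = a) : window x k n = List.replicate n a := by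
  refine List.eq_replicate_iff.2 ⟨by simp, fun b hb => ?_⟩
  simp only [window, List.mem_map, List.mem_range] at hb
  obtain ⟨i, hi, rfl⟩ := hb
  exact h i hi

theorem window_eq_gapBlock {x : ℤ → Fin 2} {k : ℤ} {s : ℕ} (hk : x k = 1)
    (h : ∀ i < s, x (k + 1 + (i : ℕ)) = 0) : window x k (s + 1) = gapBlock s := by
  rw [window_succ, hk, window_eq_replicate h, gapBlock]

theorem appears_iff_exists_window {A : Type*} {w : List A} {x : ℤ → A} :
    Appears w x ↔ ∃ k, window x k w.length = w := by
  refine exists_congr fun k => ⟨fun h => ?_, fun h i => ?_⟩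
  · refine List.ext_getElem (by simp) fun i h₁ h₂ => ?_
    simpa [window] using h ⟨i, h₂⟩
  · have := List.getElem_of_eq h.symm i.2
    simpa [window] using this.symm

theorem inLanguage_closure_iff {A : Type*} [TopologicalSpace A] [DiscreteTopology A]
    {X : Set (ℤ → A)} {w : List A} : InLanguage (closure X) w ↔ InLanguage X w := by
  refine ⟨?_, fun ⟨x, hx, h⟩ => ⟨x, subset_closure hx, h⟩⟩
  rintro ⟨x, hx, k, hk⟩
  have ho : IsOpen {y : ℤ → A | ∀ i : Fin w.length, y (k + (i : ℕ)) = w.get i} := by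
    simp only [Set.ofPred_forall]
    refine isOpen_iInter_of_finite fun i => ?_
    exact (isOpen_discrete {w.get i}).preimage
      (continuous_apply (A := fun _ : ℤ => A) (k + ((i : ℕ) : ℤ)))
  obtain ⟨y, hy, hyX⟩ := mem_closure_iff.1 hx _ ho hk
  exact ⟨y, hyX, k, hy⟩

/-- The words of length `n` of the language of `X`. -/
def languageWords {A : Type*} (X : Set (ℤ → A)) (n : ℕ) : Set (List A) :=
  {w | w.length = n ∧ InLanguage X w}

theorem mem_languageWords_iff {A : Type*} {X : Set (ℤ → A)} {n : ℕ} {w : List A} :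
    w ∈ languageWords X n ↔ ∃ x ∈ X, ∃ k, window x k n = w := by
  constructor
  · rintro ⟨rfl, x, hx, h⟩
    exact ⟨x, hx, appears_iff_exists_window.1 h⟩
  · rintro ⟨x, hx, k, rfl⟩
    exact ⟨by simp, x, hx, appears_iff_exists_window.2 ⟨k, by simp⟩⟩

theorem finite_languageWords {A : Type*} [Finite A] (X : Set (ℤ → A)) (n : ℕ) :
    (languageWords X n).Finite :=
  (List.finite_length_eq A n).subset fun _ h => h.1

theorem ncard_languageWords_pos {A : Type*} [Finite A] {X : Set (ℤ → A)} (hX : X.Nonempty)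
    (n : ℕ) : 0 < (languageWords X n).ncard := by
  obtain ⟨x, hx⟩ := hX
  exact (Set.ncard_pos (finite_languageWords X n)).2
    ⟨_, mem_languageWords_iff.2 ⟨x, hx, 0, rfl⟩⟩

theorem ncard_languageWords_add_le {A : Type*} [Finite A] (X : Set (ℤ → A)) (m n : ℕ) :
    (languageWords X (m + n)).ncard ≤ (languageWords X m).ncard * (languageWords X n).ncard := by
  rw [← Set.ncard_prod]
  refine Set.ncard_le_ncard_of_injOn (fun w => (w.take m, w.drop m)) ?_ ?_
    ((finite_languageWords X m).prod (finite_languageWords X n))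
  · intro w hw
    obtain ⟨x, hx, k, rfl⟩ := mem_languageWords_iff.1 hw
    rw [window_add, List.take_left' (by simp), List.drop_left' (by simp)]
    exact ⟨mem_languageWords_iff.2 ⟨x, hx, k, rfl⟩, mem_languageWords_iff.2 ⟨x, hx, _, rfl⟩⟩
  · intro v _ w _ h
    simp only [Prod.mk.injEq] at h
    rw [← List.take_append_drop m v, h.1, h.2, List.take_append_drop]

theorem exists_le_lt_of_strictMono {t : ℤ → ℤ} (ht : StrictMono t) (m : ℤ) :
    ∃ i, t i ≤ m ∧ m < t (i + 1) := by
  have hadd : ∀ (i : ℤ) (n : ℕ), t i + n ≤ t (i + n) := by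
    intro i n
    induction n with
    | zero => simp
    | succ n ih =>
      have := ht (show i + (n : ℤ) < i + (n + 1 : ℕ) by push_cast; omega)
      push_cast at this ⊢
      omega
  obtain ⟨i, hi, hmax⟩ := Int.exists_greatest_of_bdd (P := fun i => t i ≤ m)
    ⟨(m - t 0).toNat, fun z hz => by
      by_contra! h
      have h₁ := hadd 0 (m - t 0).toNat
      have h₂ := ht h
      simp only [zero_add] at h₁
      omega⟩
    ⟨-(t 0 - m).toNat, by
      have h := hadd (-(t 0 - m).toNat) (t 0 - m).toNat
      simp only [neg_add_cancel] at h
      omega⟩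
  refine ⟨i, hi, ?_⟩
  by_contra! h
  have := hmax _ h
  omega

theorem indicator_range_mem_SGapCore {S : Set ℕ} {t : ℤ → ℤ} (ht : StrictMono t)
    (hS : ∀ i, (t (i + 1) - t i - 1).toNat ∈ S) :
    (Set.range t).indicator (1 : ℤ → Fin 2) ∈ SGapCore S := by
  refine ⟨t, ht, fun i => by simp, fun i k h₁ h₂ => ?_, hS, exists_le_lt_of_strictMono ht⟩
  refine Set.indicator_of_notMem ?_ _
  rintro ⟨j, rfl⟩
  have := ht.lt_iff_lt.1 h₁
  have := ht.lt_iff_lt.1 h₂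
  omega

theorem IsGapConcat.exists_window_eq {S : Set ℕ} (hS : S.Nonempty) {w : List (Fin 2)}
    (hw : IsGapConcat S w) :
    ∃ t : ℤ → ℤ, StrictMono t ∧ t 0 = 0 ∧ (∀ i, (t (i + 1) - t i - 1).toNat ∈ S) ∧
      window ((Set.range t).indicator (1 : ℤ → Fin 2)) 0 w.length = w := by
  induction hw with
  | nil =>
    obtain ⟨s, hs⟩ := hS
    refine ⟨fun i => i * (s + 1), ?_, by simp, fun i => ?_, by simp⟩
    · exact strictMono_int_of_lt_succ fun i => by nlinarith
    · convert hs
      ring_nf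
      simp
  | @cons s w hs _ ih =>
    obtain ⟨t, ht, ht0, htS, htw⟩ := ih
    set u : ℤ → ℤ := fun i => if i ≤ 1 then i * (s + 1) else t (i - 1) + (s + 1) with hu
    have hu_neg : ∀ i ≤ 0, u (i + 1) = u i + (s + 1) := by
      intro i hi
      simp only [hu, if_pos (show i ≤ 1 by omega), if_pos (show i + 1 ≤ 1 by omega)]
      ring
    have hu_pos : ∀ i, 0 ≤ i → u (i + 1) = t i + (s + 1) := by
      intro i hi
      rcases hi.eq_or_lt with rfl | hi
      · simp [hu, ht0]
      · simp [hu, if_neg (show ¬ i + 1 ≤ 1 by omega)]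
    have hu0 : u 0 = 0 := by simp [hu]
    have hu_step : ∀ i, 0 < i → u (i + 1) - u i = t (i - 1 + 1) - t (i - 1) := by
      intro i hi
      have h := hu_pos (i - 1) (by omega)
      rw [sub_add_cancel] at h ⊢
      rw [h, hu_pos i hi.le]
      ring
    have humono : StrictMono u := strictMono_int_of_lt_succ fun i => by
      rcases le_or_gt i 0 with hi | hi
      · rw [hu_neg i hi]; omega
      · have := hu_step i hi
        have := ht (show i - 1 < i - 1 + 1 by omega)
        omega
    refine ⟨u, humono, hu0, fun i => ?_, ?_⟩
    · rcases le_or_gt i 0 with hi | hi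
      · rw [hu_neg i hi]
        convert hs
        omega
      · rw [hu_step i hi]
        exact htS _
    · have hlen : (gapBlock s ++ w).length = (s + 1) + w.length := by
        simp [gapBlock, add_right_comm]
      rw [hlen, window_add]
      congr 1
      · have hmem : (0 : ℤ) ∈ Set.range u := ⟨0, hu0⟩
        refine window_eq_gapBlock (Set.indicator_of_mem hmem _) fun i hi => ?_
        refine Set.indicator_of_notMem ?_ _
        rintro ⟨j, hj⟩
        have h₁ : 0 < j := humono.lt_iff_lt.1 (by omega)
        have h₂ : j < 0 + 1 := humono.lt_iff_lt.1 (by rw [hu_neg 0 le_rfl]; omega)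
        omega
      · refine Eq.trans (window_congr fun i _ => ?_) htw
        have hiff : (0 + ((s + 1 : ℕ) : ℤ) + (i : ℤ) ∈ Set.range u) ↔
            (0 + (i : ℤ) ∈ Set.range t) := by
          constructor
          · rintro ⟨j, hj⟩
            have hj0 : 0 < j := humono.lt_iff_lt.1 (by omega)
            have h := hu_pos (j - 1) (by omega)
            rw [sub_add_cancel] at h
            exact ⟨j - 1, by push_cast at hj; omega⟩
          · rintro ⟨j, hj⟩
            have hj0 : 0 ≤ j := ht.le_iff_le.1 (by omega)
            exact ⟨j + 1, by rw [hu_pos j hj0]; push_cast; omega⟩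
        by_cases h : 0 + (i : ℤ) ∈ Set.range t
        · rw [Set.indicator_of_mem h, Set.indicator_of_mem (hiff.2 h)]
          rfl
        · rw [Set.indicator_of_notMem h, Set.indicator_of_notMem (mt hiff.1 h)]

/-- The words of length `n` that are concatenations of blocks `1 0^s` with `s ∈ S`. -/
def gapConcats (S : Set ℕ) (n : ℕ) : Set (List (Fin 2)) :=
  {w | w.length = n ∧ IsGapConcat S w}

theorem finite_gapConcats (S : Set ℕ) (n : ℕ) : (gapConcats S n).Finite :=
  (List.finite_length_eq (Fin 2) n).subset fun _ h => h.1

theorem gapConcats_subset_languageWords {S : Set ℕ} (hS : S.Nonempty) (n : ℕ) :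
    gapConcats S n ⊆ languageWords (SGapCore S) n := by
  rintro w ⟨rfl, hw⟩
  obtain ⟨t, ht, -, htS, htw⟩ := hw.exists_window_eq hS
  exact mem_languageWords_iff.2 ⟨_, indicator_range_mem_SGapCore ht htS, 0, htw⟩

theorem IsGapConcat.head?_ne {S : Set ℕ} {w : List (Fin 2)} (hw : IsGapConcat S w) :
    w.head? ≠ some 0 := by
  cases hw <;> simp [gapBlock]

theorem replicate_append_inj {α : Type*} {a : α} :
    ∀ {m n : ℕ} {v w : List α}, v.head? ≠ some a → w.head? ≠ some a →
      List.replicate m a ++ v = List.replicate n a ++ w → m = n ∧ v = w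
  | 0, 0, _, _, _, _, h => by simpa using h
  | 0, _ + 1, _, _, hv, _, h => by simp_all [List.replicate_succ]
  | _ + 1, 0, _, _, _, hw, h => by
    rw [List.replicate_zero, List.nil_append] at h
    simp [← h, List.replicate_succ] at hw
  | m + 1, n + 1, v, w, hv, hw, h => by
    have := replicate_append_inj (m := m) (n := n) hv hw
      (by simpa [List.replicate_succ] using h)
    simpa using this

theorem gapConcats_zero (S : Set ℕ) : gapConcats S 0 = {[]} := by
  ext w
  simp only [gapConcats, Set.mem_ofPred_eq, List.length_eq_zero_iff, Set.mem_singleton_iff]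
  exact ⟨And.left, by rintro rfl; exact ⟨rfl, .nil⟩⟩

theorem gapConcats_succ (S : Set ℕ) (n : ℕ) :
    gapConcats S (n + 1) =
      ⋃ s ∈ S ∩ Set.Iio (n + 1), (gapBlock s ++ ·) '' gapConcats S (n - s) := by
  ext w
  simp only [Set.mem_iUnion, Set.mem_image, exists_prop]
  constructor
  · rintro ⟨hlen, hw⟩
    cases hw with
    | nil => simp at hlen
    | @cons s v hs hv =>
      simp only [gapBlock, List.length_append, List.length_cons, List.length_replicate] at hlen
      exact ⟨s, ⟨hs, by simp only [Set.mem_Iio]; omega⟩, v, ⟨by omega, hv⟩, rfl⟩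
  · rintro ⟨s, ⟨hs, hsn⟩, v, ⟨hlen, hv⟩, rfl⟩
    simp only [Set.mem_Iio] at hsn
    exact ⟨by simp [gapBlock]; omega, .cons hs hv⟩

theorem ncard_gapConcats_succ (S : Set ℕ) [DecidablePred (· ∈ S)] (n : ℕ) :
    (gapConcats S (n + 1)).ncard =
      ∑ s ∈ Finset.range (n + 1), if s ∈ S then (gapConcats S (n - s)).ncard else 0 := by
  have hfin : (S ∩ Set.Iio (n + 1)).Finite := (Set.finite_Iio _).inter_of_right _
  rw [gapConcats_succ, hfin.ncard_biUnion fun s _ => (finite_gapConcats S _).image _]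
  · have hset : S ∩ Set.Iio (n + 1) = ↑((Finset.range (n + 1)).filter (· ∈ S)) := by
      ext s
      simp [and_comm]
    rw [hset, finsum_mem_coe_finset, Finset.sum_filter]
    refine Finset.sum_congr rfl fun s _ => ?_
    rw [(List.append_right_injective _).injOn.ncard_image]
  · intro s _ r _ hsr
    refine Set.disjoint_left.2 ?_
    rintro _ ⟨v, ⟨-, hv⟩, rfl⟩ ⟨u, ⟨-, hu⟩, h⟩
    simp only [gapBlock, List.cons_append, List.cons.injEq, true_and] at h
    exact hsr (replicate_append_inj hu.head?_ne hv.head?_ne h).1.symm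

theorem exists_gapConcat_window {S : Set ℕ} {x : ℤ → Fin 2} {t : ℤ → ℤ} (ht : StrictMono t)
    (hone : ∀ i, x (t i) = 1) (hzero : ∀ i k, t i < k → k < t (i + 1) → x k = 0)
    (hS : ∀ i, (t (i + 1) - t i - 1).toNat ∈ S) (n : ℕ) (i : ℤ) :
    ∃ d j, IsGapConcat S d ∧ window x (t i) (n + 1) = d ++ gapBlock j := by
  induction n using Nat.strong_induction_on generalizing i with
  | _ n ih =>
    rcases lt_or_ge (t i + n) (t (i + 1)) with h | h
    · exact ⟨[], n, .nil, window_eq_gapBlock (hone i) fun k hk =>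
        hzero i _ (by omega) (by omega)⟩
    · have hlt := ht (show i < i + 1 by omega)
      obtain ⟨s, hs⟩ : ∃ s, s = (t (i + 1) - t i - 1).toNat := ⟨_, rfl⟩
      obtain ⟨d, j, hd, hw⟩ := ih (n - (s + 1)) (by omega) (i + 1)
      refine ⟨gapBlock s ++ d, j, .cons (hs ▸ hS i) hd, ?_⟩
      rw [show n + 1 = (s + 1) + (n - (s + 1) + 1) by omega, window_add,
        window_eq_gapBlock (hone i) fun k hk => hzero i _ (by omega) (by omega),
        show t i + ((s + 1 : ℕ) : ℤ) = t (i + 1) by omega, hw, List.append_assoc]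

theorem window_mem_SGapCore {S : Set ℕ} {x : ℤ → Fin 2} (hx : x ∈ SGapCore S) (n : ℕ) (k : ℤ) :
    window x k n = List.replicate n 0 ∨
      ∃ i d j, IsGapConcat S d ∧ window x k n = List.replicate i 0 ++ (d ++ gapBlock j) := by
  obtain ⟨t, ht, hone, hzero, hS, hcov⟩ := hx
  induction n generalizing k with
  | zero => simp
  | succ n ih =>
    obtain ⟨i, hi, hi'⟩ := hcov k
    rcases hi.eq_or_lt with rfl | hi
    · obtain ⟨d, j, hd, hw⟩ := exists_gapConcat_window ht hone hzero hS n i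
      exact .inr ⟨0, d, j, hd, by simpa using hw⟩
    · rw [window_succ, hzero i k hi hi']
      rcases ih (k + 1) with h | ⟨i, d, j, hd, h⟩
      · exact .inl (by rw [h, List.replicate_succ])
      · exact .inr ⟨i + 1, d, j, hd, by rw [h, List.replicate_succ, List.cons_append]⟩

theorem ncard_languageWords_le (S : Set ℕ) (n : ℕ) :
    (languageWords (SGapCore S) n).ncard ≤
      1 + ∑ p ∈ Finset.range n ×ˢ Finset.range n, (gapConcats S p.2).ncard := by
  have hsub : languageWords (SGapCore S) n ⊆ {List.replicate n 0} ∪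
      ⋃ p ∈ Finset.range n ×ˢ Finset.range n,
        (fun d => List.replicate p.1 0 ++ (d ++ gapBlock (n - 1 - p.1 - p.2))) ''
          gapConcats S p.2 := by
    intro w hw
    obtain ⟨x, hx, k, rfl⟩ := mem_languageWords_iff.1 hw
    rcases window_mem_SGapCore hx n k with h | ⟨i, d, j, hd, h⟩
    · exact .inl h
    · have hlen := congrArg List.length h
      simp only [length_window, List.length_append, List.length_replicate, gapBlock,
        List.length_cons] at hlen
      simp only [Set.mem_union, Set.mem_iUnion, exists_prop]
      refine .inr ⟨(i, d.length), ?_, d, ⟨rfl, hd⟩, ?_⟩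
      · simp only [Finset.mem_product, Finset.mem_range]
        omega
      · rw [h, show n - 1 - i - d.length = j by omega]
  have himage : ∀ p : ℕ × ℕ,
      ((fun d => List.replicate p.1 0 ++ (d ++ gapBlock (n - 1 - p.1 - p.2))) ''
        gapConcats S p.2).Finite := fun p => (finite_gapConcats S p.2).image _
  refine (Set.ncard_le_ncard hsub ((Set.finite_singleton _).union
    ((Finset.finite_toSet _).biUnion fun p _ => himage p))).trans ?_
  refine (Set.ncard_union_le _ _).trans ?_
  rw [Set.ncard_singleton]
  gcongr
  refine (Finset.set_ncard_biUnion_le _ _).trans (Finset.sum_le_sum fun p _ => ?_)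
  exact Set.ncard_image_le (finite_gapConcats S p.2)

/-- The coefficients `λ^(s+1)`, `s ∈ S`, of the characteristic equation. -/
noncomputable def gapWeight (S : Set ℕ) (lam : ℝ) : ℕ → ℝ :=
  S.indicator fun s => lam ^ (s + 1)

theorem gapWeight_nonneg (S : Set ℕ) {lam : ℝ} (hpos : 0 < lam) (s : ℕ) :
    0 ≤ gapWeight S lam s :=
  Set.indicator_nonneg (fun _ _ => by positivity) s

theorem hasSum_gapWeight {S : Set ℕ} {lam : ℝ} (hsol : ∑' s : S, lam ^ ((s : ℕ) + 1) = 1) :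
    HasSum (gapWeight S lam) 1 := by
  have htsum : ∑' s, gapWeight S lam s = 1 :=
    (tsum_subtype S fun s => lam ^ (s + 1)).symm.trans hsol
  have hsum : Summable (gapWeight S lam) := by
    by_contra h
    simp [tsum_eq_zero_of_not_summable h] at htsum
  exact htsum ▸ hsum.hasSum

theorem weighted_ncard_gapConcats_succ (S : Set ℕ) (lam : ℝ) (n : ℕ) :
    ((gapConcats S (n + 1)).ncard : ℝ) * lam ^ (n + 1) =
      ∑ s ∈ Finset.range (n + 1),
        gapWeight S lam s * ((gapConcats S (n - s)).ncard * lam ^ (n - s)) := by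
  classical
  rw [ncard_gapConcats_succ, Nat.cast_sum, Finset.sum_mul]
  refine Finset.sum_congr rfl fun s hs => ?_
  rw [Finset.mem_range] at hs
  by_cases h : s ∈ S
  · rw [if_pos h, gapWeight, Set.indicator_of_mem h, show n + 1 = (s + 1) + (n - s) by omega,
      pow_add]
    ring
  · simp [gapWeight, h]

theorem weighted_ncard_gapConcats_le_one {S : Set ℕ} {lam : ℝ} (hpos : 0 < lam)
    (hsum : HasSum (gapWeight S lam) 1) (n : ℕ) :
    ((gapConcats S n).ncard : ℝ) * lam ^ n ≤ 1 := by
  induction n using Nat.strong_induction_on with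
  | _ n ih =>
    cases n with
    | zero => simp [gapConcats_zero]
    | succ n =>
      rw [weighted_ncard_gapConcats_succ]
      calc _ ≤ ∑ s ∈ Finset.range (n + 1), gapWeight S lam s :=
            Finset.sum_le_sum fun s _ =>
              mul_le_of_le_one_right (gapWeight_nonneg S hpos s) (ih _ (by omega))
        _ ≤ 1 := sum_le_hasSum _ (fun s _ => gapWeight_nonneg S hpos s) hsum

theorem not_summable_weighted_ncard_gapConcats {S : Set ℕ} {lam : ℝ}
    (hsum : HasSum (gapWeight S lam) 1) :
    ¬ Summable fun n => ((gapConcats S n).ncard : ℝ) * lam ^ n := by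
  intro h
  have hprod := tsum_mul_tsum_eq_tsum_sum_range_of_summable_norm hsum.summable.norm h.norm
  simp only [← weighted_ncard_gapConcats_succ] at hprod
  have hzero := h.tsum_eq_zero_add
  rw [← hprod, hsum.tsum_eq] at hzero
  simp [gapConcats_zero] at hzero

theorem ncard_languageWords_le_mul_inv_pow {S : Set ℕ} {lam : ℝ} (hpos : 0 < lam) (hle : lam ≤ 1)
    (hsum : HasSum (gapWeight S lam) 1) {n : ℕ} (hn : 1 ≤ n) :
    ((languageWords (SGapCore S) n).ncard : ℝ) ≤ 2 * (n : ℝ) ^ 2 * (1 / lam) ^ n := by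
  have hone : 1 ≤ 1 / lam := (one_le_div hpos).2 hle
  have hterm : ∀ p ∈ Finset.range n ×ˢ Finset.range n,
      ((gapConcats S p.2).ncard : ℝ) ≤ (1 / lam) ^ n := by
    intro p hp
    simp only [Finset.mem_product, Finset.mem_range] at hp
    calc ((gapConcats S p.2).ncard : ℝ) ≤ (1 / lam) ^ p.2 := by
          rw [one_div_pow, le_div_iff₀ (by positivity)]
          exact weighted_ncard_gapConcats_le_one hpos hsum p.2
      _ ≤ (1 / lam) ^ n := pow_le_pow_right₀ hone hp.2.le
  have hcount : ((languageWords (SGapCore S) n).ncard : ℝ) ≤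
      1 + ∑ p ∈ Finset.range n ×ˢ Finset.range n, ((gapConcats S p.2).ncard : ℝ) := by
    exact_mod_cast ncard_languageWords_le S n
  have hbound := Finset.sum_le_card_nsmul _ _ _ hterm
  simp only [Finset.card_product, Finset.card_range, nsmul_eq_mul, Nat.cast_mul] at hbound
  have hpow : 1 ≤ (1 / lam) ^ n := one_le_pow₀ hone
  have hn' : (1 : ℝ) ≤ n := by exact_mod_cast hn
  nlinarith [mul_le_mul (one_le_pow₀ hn' (n := 2)) hpow zero_le_one (by positivity)]

theorem SGapCore_nonempty {S : Set ℕ} (hS : S.Nonempty) : (SGapCore S).Nonempty := by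
  obtain ⟨t, ht, -, htS, -⟩ := IsGapConcat.nil.exists_window_eq hS
  exact ⟨_, indicator_range_mem_SGapCore ht htS⟩

theorem exists_hasEntropy {A : Type*} [Finite A] {X : Set (ℤ → A)} (hX : X.Nonempty) :
    ∃ h, HasEntropy X h := by
  have hpos : ∀ n, (0 : ℝ) < (languageWords X n).ncard := fun n => by
    exact_mod_cast ncard_languageWords_pos hX n
  have hsub : Subadditive fun n => Real.log (languageWords X n).ncard := by
    intro m n
    rw [← Real.log_mul (hpos m).ne' (hpos n).ne']
    refine Real.log_le_log (hpos _) ?_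
    exact_mod_cast ncard_languageWords_add_le X m n
  refine ⟨hsub.lim, hsub.tendsto_lim ⟨0, ?_⟩⟩
  rintro _ ⟨n, rfl⟩
  exact div_nonneg (Real.log_natCast_nonneg _) (Nat.cast_nonneg n)

theorem le_log_of_hasEntropy_SGapCore {S : Set ℕ} (hS : S.Nonempty) {lam h : ℝ} (hpos : 0 < lam)
    (hle : lam ≤ 1) (hsum : HasSum (gapWeight S lam) 1) (hent : HasEntropy (SGapCore S) h) :
    h ≤ Real.log (1 / lam) := by
  have hlog : Tendsto (fun n : ℕ => Real.log n / n) atTop (𝓝 0) :=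
    Real.isLittleO_log_id_atTop.tendsto_div_nhds_zero.comp tendsto_natCast_atTop_atTop
  have hlim : Tendsto (fun n : ℕ => Real.log 2 / n + 2 * (Real.log n / n) + Real.log (1 / lam))
      atTop (𝓝 (Real.log (1 / lam))) := by
    simpa using ((tendsto_const_div_atTop_nhds_zero_nat (Real.log 2)).add
      (hlog.const_mul 2)).add_const (Real.log (1 / lam))
  refine le_of_tendsto_of_tendsto hent hlim ?_
  filter_upwards [eventually_ge_atTop 1] with n hn
  have hn' : (0 : ℝ) < n := by exact_mod_cast hn
  have hcount : (0 : ℝ) < (languageWords (SGapCore S) n).ncard := by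
    exact_mod_cast ncard_languageWords_pos (SGapCore_nonempty hS) n
  have hmono := Real.log_le_log hcount (ncard_languageWords_le_mul_inv_pow hpos hle hsum hn)
  rw [Real.log_mul (by positivity) (by positivity), Real.log_mul (by positivity) (by positivity),
    Real.log_pow, Real.log_pow] at hmono
  change Real.log (languageWords (SGapCore S) n).ncard / n ≤ _
  rw [div_le_iff₀ hn']
  refine hmono.trans_eq ?_
  field_simp
  push_cast
  ring

theorem log_le_of_hasEntropy_SGapCore {S : Set ℕ} (hS : S.Nonempty) {lam h : ℝ} (hpos : 0 < lam)
    (hsum : HasSum (gapWeight S lam) 1) (hent : HasEntropy (SGapCore S) h) :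
    Real.log (1 / lam) ≤ h := by
  by_contra! hlt
  obtain ⟨r, hr, hrlam⟩ := exists_between hlt
  have hratio : Real.exp r * lam < 1 := by
    rwa [← lt_div_iff₀ hpos, ← Real.lt_log_iff_exp_lt (by positivity)]
  refine not_summable_weighted_ncard_gapConcats hsum
    (Summable.of_norm_bounded_eventually_nat
      (summable_geometric_of_lt_one (by positivity) hratio) ?_)
  filter_upwards [hent.eventually_lt_const hr, eventually_ge_atTop 1] with n hn hn1
  have hn' : (0 : ℝ) < n := by exact_mod_cast hn1
  have hcount : (0 : ℝ) < (languageWords (SGapCore S) n).ncard := by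
    exact_mod_cast ncard_languageWords_pos (SGapCore_nonempty hS) n
  have hsub : ((gapConcats S n).ncard : ℝ) ≤ (languageWords (SGapCore S) n).ncard := by
    exact_mod_cast Set.ncard_le_ncard (gapConcats_subset_languageWords hS n)
      (finite_languageWords _ n)
  change Real.log (languageWords (SGapCore S) n).ncard / n < r at hn
  rw [div_lt_iff₀ hn', Real.log_lt_iff_lt_exp hcount, mul_comm, Real.exp_nat_mul] at hn
  rw [Real.norm_of_nonneg (by positivity), mul_pow]
  gcongr
  exact hsub.trans hn.le

/-- **Entropy of S-gap shifts.**  If `S ⊆ ℕ₀` is nonempty and `λ ∈ (0,1]` is the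
unique positive solution of `∑_{s ∈ S} x^{s+1} = 1`, then the topological entropy
of `X(S)` is `log (1/λ)`. -/
theorem entropy_SGapShift (S : Set ℕ) (hS : S.Nonempty) (lam : ℝ)
    (hpos : 0 < lam) (hle : lam ≤ 1)
    (hsol : ∑' s : S, lam ^ ((s : ℕ) + 1) = 1)
    (huniq : ∀ x : ℝ, 0 < x → (∑' s : S, x ^ ((s : ℕ) + 1)) = 1 → x = lam) :
    HasEntropy (SGapShift S) (Real.log (1 / lam)) := by
  have hsum := hasSum_gapWeight hsol
  obtain ⟨h, hent⟩ := exists_hasEntropy (SGapCore_nonempty hS)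
  have heq : h = Real.log (1 / lam) :=
    le_antisymm (le_log_of_hasEntropy_SGapCore hS hpos hle hsum hent)
      (log_le_of_hasEntropy_SGapCore hS hpos hsum hent)
  subst heq
  simpa only [HasEntropy, SGapShift, inLanguage_closure_iff] using hent
end

section
/- Let λ > 1 be a real number. For every integer p ≥ 2⌈λ⌉ − 1, there exist uncountably many pairwise non-conjugate S-graph shifts on p vertices that have the specification property and topological entropy log λ. -/
open Filter Topology

/-- `X` has the specification property: there is `N` such that any two words of
the language can be glued with a connecting word of length exactly `N`. -/
def HasSpecification {A : Type*} (X : Set (ℤ → A)) : Prop :=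
  ∃ N : ℕ, ∀ α β : List A, InLanguage X α → InLanguage X β →
    ∃ γ : List A, γ.length = N ∧ InLanguage X (α ++ γ ++ β)

/-- Two shift spaces are conjugate: there is a shift-commuting homeomorphism
between them. -/
def Conjugate {A B : Type*} [TopologicalSpace A] [TopologicalSpace B]
    (X : Set (ℤ → A)) (Y : Set (ℤ → B)) : Prop :=
  ∃ (φ : (ℤ → A) → (ℤ → B)) (ψ : (ℤ → B) → (ℤ → A)),
    Set.MapsTo φ X Y ∧ Set.MapsTo ψ Y X ∧
    ContinuousOn φ X ∧ ContinuousOn ψ Y ∧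
    (∀ x ∈ X, ψ (φ x) = x) ∧ (∀ y ∈ Y, φ (ψ y) = y) ∧
    (∀ x ∈ X, φ (shiftMap x) = shiftMap (φ x))

section Conjugacy

/-- Translation of a bi-infinite sequence by an arbitrary integer. -/
def shiftBy {A : Type*} (n : ℤ) (x : ℤ → A) : ℤ → A := fun i => x (i + n)

theorem continuous_shiftBy {A : Type*} [TopologicalSpace A] (n : ℤ) :
    Continuous (shiftBy n : (ℤ → A) → ℤ → A) :=
  continuous_pi fun i => continuous_apply (i + n)

/-- Invariance under all integer translations. -/
def TranslationInvariant {A : Type*} (X : Set (ℤ → A)) : Prop :=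
  ∀ n : ℤ, ∀ x ∈ X, shiftBy n x ∈ X

theorem TranslationInvariant.closure {A : Type*} [TopologicalSpace A] {X : Set (ℤ → A)}
    (hX : TranslationInvariant X) : TranslationInvariant (closure X) := fun n _ hx =>
  (Set.MapsTo.closure (fun y hy => hX n y hy) (continuous_shiftBy n)) hx

theorem shiftMap_shiftBy {A : Type*} (n : ℤ) (x : ℤ → A) :
    shiftMap (shiftBy n x) = shiftBy (n + 1) x := by
  funext i; simp only [shiftBy, shiftMap]; congr 1; ring

theorem shiftMap_injective {A : Type*} :
    Function.Injective (shiftMap : (ℤ → A) → ℤ → A) := fun x y h => by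
  funext i
  simpa [shiftMap] using congrFun h (i - 1)

theorem map_shiftBy_of_map_shift {A B : Type*} {X : Set (ℤ → A)} (hX : TranslationInvariant X)
    {φ : (ℤ → A) → ℤ → B} (hφ : ∀ x ∈ X, φ (shiftMap x) = shiftMap (φ x)) (n : ℤ) :
    ∀ x ∈ X, φ (shiftBy n x) = shiftBy n (φ x) := by
  induction n using Int.induction_on with
  | zero => intro x _; unfold shiftBy; simp only [add_zero]
  | succ k ih =>
    intro x hx
    rw [← shiftMap_shiftBy, hφ _ (hX k x hx), ih x hx, shiftMap_shiftBy]
  | pred k ih =>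
    intro x hx
    refine shiftMap_injective ?_
    rw [← hφ _ (hX _ x hx), shiftMap_shiftBy, shiftMap_shiftBy, sub_add_cancel, ih x hx]

theorem Conjugate.symm {A B : Type*} [TopologicalSpace A] [TopologicalSpace B]
    {X : Set (ℤ → A)} {Y : Set (ℤ → B)} (hX : TranslationInvariant X)
    (h : Conjugate X Y) : Conjugate Y X := by
  obtain ⟨φ, ψ, h1, h2, h3, h4, h5, h6, h7⟩ := h
  refine ⟨ψ, φ, h2, h1, h4, h3, h6, h5, fun y hy => ?_⟩
  have hs : shiftMap (ψ y) ∈ X := hX 1 _ (h2 hy)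
  have := h7 _ (h2 hy)
  rw [h6 y hy] at this
  rw [← this, h5 _ hs]

theorem countable_setOf_conjugate {A B : Type*} [TopologicalSpace A] [DiscreteTopology A]
    [Finite A] [TopologicalSpace B] [DiscreteTopology B] [Finite B]
    {X : Set (ℤ → A)} (hc : IsClosed X) (hX : TranslationInvariant X) :
    {Y : Set (ℤ → B) | Conjugate X Y}.Countable := by
  have : CompactSpace X := isCompact_iff_compactSpace.1 hc.isCompact
  have : Countable (TopologicalSpace.Clopens X) :=
    TopologicalSpace.Clopens.countable_iff_secondCountable.2 inferInstance
  let image : (B → TopologicalSpace.Clopens X) → Set (ℤ → B) := fun U =>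
    {y | ∃ x : X, ∀ (i : ℤ) (b : B), y i = b ↔ ⟨shiftBy i x.1, hX i x.1 x.2⟩ ∈ U b}
  refine (Set.countable_range image).mono ?_
  rintro Y ⟨φ, ψ, h1, h2, h3, h4, h5, h6, h7⟩
  have hcont : Continuous fun x : X => φ x.1 0 :=
    (continuous_apply 0).comp (continuousOn_iff_continuous_domRestrict.1 h3)
  refine ⟨fun b => ⟨(fun x : X => φ x.1 0) ⁻¹' {b}, (isClopen_discrete {b}).preimage hcont⟩, ?_⟩
  have key : ∀ x ∈ X, ∀ i, φ (shiftBy i x) 0 = φ x i := fun x hx i => by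
    rw [map_shiftBy_of_map_shift hX h7 i x hx]; simp [shiftBy]
  ext y
  constructor
  · rintro ⟨x, hx⟩
    have : y = φ x.1 := by
      funext i
      refine (hx i _).2 ?_
      exact key x.1 x.2 i
    rw [this]
    exact h1 x.2
  · intro hy
    refine ⟨⟨ψ y, h2 hy⟩, fun i b => ?_⟩
    change y i = b ↔ φ (shiftBy i (ψ y)) 0 = b
    rw [key _ (h2 hy), h6 y hy]

/-- An uncountable family of shift spaces contains an uncountable family of pairwise
non-conjugate ones. -/
theorem exists_uncountable_pairwise_not_conjugate {A : Type*} [TopologicalSpace A]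
    [DiscreteTopology A] [Finite A] {ℱ : Set (Set (ℤ → A))} (hℱ : ¬ ℱ.Countable)
    (hc : ∀ X ∈ ℱ, IsClosed X) (hinv : ∀ X ∈ ℱ, TranslationInvariant X) :
    ∃ 𝒜 ⊆ ℱ, ¬ 𝒜.Countable ∧ 𝒜.Pairwise fun X Y => ¬ Conjugate X Y := by
  obtain ⟨M, hM⟩ := zorn_subset {𝒜 | 𝒜 ⊆ ℱ ∧ 𝒜.Pairwise fun X Y => ¬ Conjugate X Y}
    (fun c hcs hch => ⟨⋃₀ c, ⟨Set.sUnion_subset fun s hs => (hcs hs).1,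
      (Set.pairwise_sUnion hch.directedOn).2 fun s hs => (hcs hs).2⟩,
      fun s hs => Set.subset_sUnion_of_mem hs⟩)
  refine ⟨M, hM.prop.1, fun hcount => hℱ ?_, hM.prop.2⟩
  have hcov : ℱ ⊆ M ∪ ⋃ X ∈ M, {Y | Conjugate X Y} := by
    intro Y hY
    by_contra hn
    simp only [Set.mem_union, Set.mem_iUnion, Set.mem_ofPred_eq, not_or, not_exists] at hn
    have hins : insert Y M ∈ {𝒜 | 𝒜 ⊆ ℱ ∧ 𝒜.Pairwise fun X Y => ¬ Conjugate X Y} := by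
      refine ⟨Set.insert_subset hY hM.prop.1, hM.prop.2.insert fun X hX _ => ?_⟩
      exact ⟨fun h => hn.2 X hX (h.symm (hinv Y hY)), hn.2 X hX⟩
    exact hn.1 (hM.le_of_ge hins (Set.subset_insert Y M) (Set.mem_insert Y M))
  refine (hcount.union (hcount.biUnion fun X hX => ?_)).mono hcov
  exact countable_setOf_conjugate (hc X (hM.prop.1 hX)) (hinv X (hM.prop.1 hX))

theorem isOpen_setOf_window {A : Type*} [TopologicalSpace A] [DiscreteTopology A]
    (w : List A) (k : ℤ) :
    IsOpen {x : ℤ → A | ∀ i : Fin w.length, x (k + (i : ℕ)) = w.get i} := by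
  simp only [Set.ofPred_forall]
  exact isOpen_iInter_of_finite fun i =>
    (isOpen_discrete {w.get i}).preimage
      (continuous_apply (A := fun _ => A) (k + ((i : ℕ) : ℤ)))

theorem translationInvariant_sGraphCore {V : Type*} (Adj : V → V → Prop) (S : V → Set ℕ) :
    TranslationInvariant (SGraphCore Adj S) := by
  rintro n x ⟨a, t, h1, h2, h3, h4, h5⟩
  refine ⟨a, fun i => t i - n, fun i j hij => by simpa using h1 hij, fun i => ?_, h3, ?_, ?_⟩
  · have := h2 i
    rwa [show t (i + 1) - n - (t i - n) = t (i + 1) - t i by ring]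
  · intro i k hik hki
    exact h4 i (k + n) (by linarith) (by linarith)
  · intro m
    obtain ⟨i, hi, hi'⟩ := h5 (m + n)
    exact ⟨i, by simp only; linarith, by simp only; linarith⟩

end Conjugacy

section Automaton

/-- The words of length `n` that a partial deterministic automaton can read from the state `s`. -/
def readableWords {σ V : Type*} (step : σ → V → Option σ) (n : ℕ) (s : σ) : Set (List V) :=
  {w | w.length = n ∧ (w.foldlM step s).isSome}

theorem finite_readableWords {σ V : Type*} [Finite V] (step : σ → V → Option σ) (n : ℕ) (s : σ) :
    (readableWords step n s).Finite :=
  (List.finite_length_eq V n).subset fun _ h => h.1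

theorem readableWords_zero {σ V : Type*} (step : σ → V → Option σ) (s : σ) :
    readableWords step 0 s = {[]} := by
  ext w
  simp only [readableWords, Set.mem_ofPred_eq, List.length_eq_zero_iff, Set.mem_singleton_iff,
    and_iff_left_iff_imp]
  rintro rfl
  rfl

theorem ncard_readableWords_succ {σ V : Type*} [Fintype V] (step : σ → V → Option σ)
    (n : ℕ) (s : σ) :
    (readableWords step (n + 1) s).ncard =
      ∑ a, (step s a).elim 0 fun s' => (readableWords step n s').ncard := by
  have hU : readableWords step (n + 1) s =
      ⋃ a, List.cons a '' ((step s a).elim ∅ fun s' => readableWords step n s') := by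
    ext w
    simp only [Set.mem_iUnion, Set.mem_image]
    constructor
    · rintro ⟨hl, hr⟩
      obtain - | ⟨a, w⟩ := w
      · simp at hl
      · rw [List.foldlM_cons] at hr
        refine ⟨a, w, ?_, rfl⟩
        obtain h | ⟨s', h⟩ := Option.eq_none_or_eq_some (step s a)
        · simp [h] at hr
        · rw [h] at hr ⊢
          exact ⟨by simpa using hl, hr⟩
    · rintro ⟨a, w, hw, rfl⟩
      obtain h | ⟨s', h⟩ := Option.eq_none_or_eq_some (step s a)
      · simp [h] at hw
      · rw [h] at hw
        refine ⟨by simpa using hw.1, ?_⟩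
        rw [List.foldlM_cons, h]
        exact hw.2
  have hfin : ∀ a, ((step s a).elim ∅ fun s' => readableWords step n s').Finite := fun a => by
    cases step s a
    · exact Set.finite_empty
    · exact finite_readableWords _ _ _
  rw [hU, Set.ncard_iUnion_of_finite (fun a => (hfin a).image _), finsum_eq_sum_of_fintype]
  · refine Finset.sum_congr rfl fun a _ => ?_
    rw [Set.ncard_image_of_injective _ (List.cons_injective)]
    cases step s a <;> simp
  · intro a b hab
    rw [Function.onFun, Set.disjoint_left]
    rintro _ ⟨u, _, rfl⟩ ⟨v, _, h⟩
    exact hab (List.cons.inj h).1.symm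

theorem ncard_readableWords_bounds {σ V : Type*} [Fintype V] (step : σ → V → Option σ)
    {lam c C : ℝ} (hc : 0 < c) (hC : 0 < C) (wt : σ → ℝ)
    (hwt : ∀ s, c ≤ wt s ∧ wt s ≤ C)
    (heig : ∀ s, ∑ a, (step s a).elim 0 wt = lam * wt s) (n : ℕ) :
    ∀ s, lam ^ n * wt s / C ≤ (readableWords step n s).ncard ∧
      ((readableWords step n s).ncard : ℝ) ≤ lam ^ n * wt s / c := by
  induction n with
  | zero =>
    intro s
    rw [readableWords_zero, Set.ncard_singleton]
    refine ⟨?_, ?_⟩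
    · rw [div_le_iff₀ hC]; simpa using (hwt s).2
    · rw [le_div_iff₀ hc]; simpa using (hwt s).1
  | succ n ih =>
    intro s
    rw [ncard_readableWords_succ, pow_succ, mul_assoc, ← heig, Finset.mul_sum, Finset.sum_div,
      Finset.sum_div]
    push_cast
    refine ⟨Finset.sum_le_sum fun a _ => ?_, Finset.sum_le_sum fun a _ => ?_⟩
    · cases step s a
      · simp
      · exact (ih _).1
    · cases step s a
      · simp
      · exact (ih _).2

theorem hasEntropy_of_bounds {A : Type*} {X : Set (ℤ → A)} {lam c C : ℝ} (hlam : 0 < lam)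
    (hc : 0 < c)
    (hlow : ∀ n, c * lam ^ n ≤ ({w : List A | w.length = n ∧ InLanguage X w}.ncard : ℝ))
    (hup : ∀ n, ({w : List A | w.length = n ∧ InLanguage X w}.ncard : ℝ) ≤ C * lam ^ n) :
    HasEntropy X (Real.log lam) := by
  have hC : 0 < C := by
    have := (hlow 0).trans (hup 0)
    simp only [pow_zero, mul_one] at this
    linarith
  have lim : ∀ K : ℝ, Tendsto (fun n : ℕ => Real.log K / n + Real.log lam) atTop
      (𝓝 (Real.log lam)) := fun K => by
    simpa using (tendsto_const_div_atTop_nhds_zero_nat (Real.log K)).add_const (Real.log lam)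
  have ev : ∀ K : ℝ, 0 < K → ∀ n : ℕ, 0 < n →
      Real.log K / n + Real.log lam = Real.log (K * lam ^ n) / n := fun K hK n hn => by
    have : (n : ℝ) ≠ 0 := by positivity
    rw [Real.log_mul hK.ne' (by positivity), Real.log_pow]
    field_simp
  refine tendsto_of_tendsto_of_tendsto_of_le_of_le' (lim c) (lim C) ?_ ?_
  · filter_upwards [eventually_gt_atTop 0] with n hn
    rw [ev c hc n hn]
    exact div_le_div_of_nonneg_right (Real.log_le_log (by positivity) (hlow n)) (by positivity)
  · filter_upwards [eventually_gt_atTop 0] with n hn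
    rw [ev C hC n hn]
    exact div_le_div_of_nonneg_right
      (Real.log_le_log (lt_of_lt_of_le (by positivity) (hlow n)) (hup n)) (by positivity)

end Automaton

section RunAutomaton

variable {V : Type*} {free : V → Prop} {S : V → Set ℕ}

/-- The graph in which distinct vertices are joined unless neither of them is free. -/
def HubAdj (free : V → Prop) (u v : V) : Prop := u ≠ v ∧ (free u ∨ free v)

/-- `none` means that the last letter read is free, and `some (v, m)` that the current run of the
non-free letter `v` has length `m + 1`. -/
abbrev RunState (free : V → Prop) := Option ({v // ¬ free v} × ℕ)

open Classical in
/-- The automaton reading the concatenations of runs with lengths in `S` along the edges of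
`HubAdj free`. -/
noncomputable def runStep (free : V → Prop) (S : V → Set ℕ) :
    RunState free → V → Option (RunState free)
  | none, a => if h : free a then some none else some (some (⟨a, h⟩, 0))
  | some (v, m), a =>
    if a = v.1 then some (some (v, m + 1)) else if free a ∧ m + 1 ∈ S v.1 then some none else none

theorem runStep_none_free {a : V} (h : free a) : runStep free S none a = some none := by
  simp [runStep, h]

theorem runStep_none_notFree (v : {v // ¬ free v}) :
    runStep free S none v.1 = some (some (v, 0)) := by
  simp [runStep, v.2]

theorem runStep_self (v : {v // ¬ free v}) (m : ℕ) :
    runStep free S (some (v, m)) v.1 = some (some (v, m + 1)) := by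
  simp [runStep]

theorem runStep_some_free {a : V} (h : free a) {v : {v // ¬ free v}} {m : ℕ} (hm : m + 1 ∈ S v.1) :
    runStep free S (some (v, m)) a = some none := by
  have : a ≠ v.1 := fun e => v.2 (e ▸ h)
  simp [runStep, h, hm, this]

theorem runStep_eq_some_none {s : RunState free} {a : V} :
    runStep free S s a = some none ↔
      free a ∧ ∀ v m, s = some (v, m) → m + 1 ∈ S v.1 := by
  obtain - | ⟨v, m⟩ := s
  · by_cases h : free a <;> simp [runStep, h]
  · constructor
    · intro h
      simp only [runStep] at h
      split_ifs at h with h1 h2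
      · simp at h
      · refine ⟨h2.1, ?_⟩
        rintro _ _ ⟨⟩
        exact h2.2
    · rintro ⟨h, hm⟩
      exact runStep_some_free h (hm v m rfl)

theorem runStep_eq_some_some {s : RunState free} {a : V} {v : {v // ¬ free v}} {m : ℕ} :
    runStep free S s a = some (some (v, m)) ↔
      a = v.1 ∧ (s = none ∧ m = 0 ∨ ∃ k, s = some (v, k) ∧ m = k + 1) := by
  obtain - | ⟨u, k⟩ := s
  · by_cases h : free a
    · simp only [runStep, h, dite_true]
      constructor
      · intro h; simp at h
      · rintro ⟨rfl, _⟩; exact absurd h v.2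
    · simp only [runStep, h, dite_false]
      simp only [Option.some.injEq, Prod.mk.injEq, Subtype.ext_iff]
      simp
      tauto
  · simp only [runStep]
    split_ifs with h1 h2
    · constructor
      · intro hh
        obtain ⟨rfl, rfl⟩ := Prod.mk.inj (Option.some.inj (Option.some.inj hh))
        exact ⟨h1, .inr ⟨k, rfl, rfl⟩⟩
      · rintro ⟨-, ⟨hh, -⟩ | ⟨k', hk, rfl⟩⟩
        · simp at hh
        · obtain ⟨rfl, rfl⟩ := Prod.mk.inj (Option.some.inj hk)
          rfl
    · have := v.2
      grind
    · grind

theorem foldlM_window {σ : Type*} {step : σ → V → Option σ} {x : ℤ → V} {s : ℤ → σ}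
    (hs : ∀ k, step (s k) (x k) = some (s (k + 1))) :
    ∀ (w : List V) (k : ℤ), (∀ i : Fin w.length, x (k + (i : ℕ)) = w.get i) →
      w.foldlM step (s k) = some (s (k + w.length)) := by
  intro w
  induction w with
  | nil => intro k _; simp
  | cons a w ih =>
    intro k h
    have h0 : x k = a := by simpa using h ⟨0, by simp⟩
    have h1 := ih (k + 1) fun i => by
      have := h i.succ
      simp only [List.get_cons_succ', Fin.val_succ, Nat.cast_add, Nat.cast_one] at this
      rw [← this]; congr 1; ring
    rw [List.foldlM_cons, ← h0, hs k]
    simp only [Option.bind_eq_bind, Option.bind_some, h1, List.length_cons]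
    congr 2; push_cast; ring

theorem exists_states_of_mem_core {x : ℤ → V} (hx : x ∈ SGraphCore (HubAdj free) S) :
    ∃ s : ℤ → RunState free, ∀ k, runStep free S (s k) (x k) = some (s (k + 1)) := by
  classical
  obtain ⟨a, t, ht, hS, hadj, hval, hcov⟩ := hx
  choose idx hidx hidx' using hcov
  let st : ℤ → RunState free := fun k =>
    if h : free (x k) then none else some (⟨x k, h⟩, (k - t (idx k)).toNat)
  refine ⟨fun k => st (k - 1), fun k => ?_⟩
  simp only [add_sub_cancel_right]
  have huniq : ∀ {i j k : ℤ}, t i ≤ k → k < t (i + 1) → t j ≤ k → k < t (j + 1) → i = j := by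
    intro i j k h1 h2 h3 h4
    have := ht.lt_iff_lt.1 (h1.trans_lt h4)
    have := ht.lt_iff_lt.1 (h3.trans_lt h2)
    omega
  obtain ⟨i, hi⟩ : ∃ i, idx (k - 1) = i := ⟨_, rfl⟩
  have hi1 := hidx (k - 1)
  have hi2 := hidx' (k - 1)
  rw [hi] at hi1 hi2
  have hxk1 : x (k - 1) = a i := hval i _ hi1 hi2
  by_cases hk : k < t (i + 1)
  · have hki : idx k = i := huniq (hidx k) (hidx' k) (by omega) hk
    have hxk : x k = a i := hval i _ (by omega) hk
    by_cases hf : free (a i)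
    · simp only [st, hxk1, hxk, hf, dite_true]
      exact runStep_none_free hf
    · simp only [st, hxk1, hxk, hf, dite_false, hki, hi]
      rw [show (k - t i).toNat = (k - 1 - t i).toNat + 1 by omega]
      exact runStep_self ⟨a i, hf⟩ _
  · have hk : k = t (i + 1) := by omega
    have hki : idx k = i + 1 := huniq (hidx k) (hidx' k) hk.ge (hk ▸ ht (by omega))
    have hxk : x k = a (i + 1) := hval (i + 1) _ hk.ge (hk ▸ ht (by omega))
    obtain ⟨hne, hor⟩ := hadj i
    by_cases hf : free (a (i + 1))
    · have e : st k = none := by simp only [st, hxk, hf, dite_true]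
      rw [e, runStep_eq_some_none, hxk]
      refine ⟨hf, fun v m hv => ?_⟩
      by_cases hf' : free (a i)
      · simp [st, hxk1, hf'] at hv
      · simp only [st, hxk1, hf', dite_false, hi, Option.some.injEq, Prod.mk.injEq] at hv
        obtain ⟨rfl, rfl⟩ := hv
        have := hS i
        rwa [show (t (i + 1) - t i).toNat = (k - 1 - t i).toNat + 1 by omega] at this
    · have hf' : free (a i) := hor.resolve_right hf
      simp only [st, hxk1, hxk, hf, hf', dite_true, dite_false, hki]
      rw [← hk, sub_self]
      exact runStep_none_notFree ⟨a (i + 1), hf⟩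

/-- An integer-indexed enumeration of a set of integers unbounded in both directions. -/
theorem exists_strictMono_enumeration {Z : Set ℤ} (hup : ∀ k, ∃ j ∈ Z, k < j)
    (hdown : ∀ k, ∃ j ∈ Z, j < k) :
    ∃ t : ℤ → ℤ, StrictMono t ∧ (∀ i, t i ∈ Z) ∧ ∀ m, ∃ i, t i ≤ m ∧ m < t (i + 1) ∧
      ∀ k, t i < k → k < t (i + 1) → k ∉ Z := by
  classical
  have : Nonempty Z := by obtain ⟨j, hj, _⟩ := hup 0; exact ⟨⟨j, hj⟩⟩
  have : NoMaxOrder Z := ⟨fun a => by obtain ⟨j, hj, h⟩ := hup a; exact ⟨⟨j, hj⟩, h⟩⟩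
  have : NoMinOrder Z := ⟨fun a => by obtain ⟨j, hj, h⟩ := hdown a; exact ⟨⟨j, hj⟩, h⟩⟩
  let : LocallyFiniteOrder Z := Subtype.instLocallyFiniteOrder (· ∈ Z)
  let : SuccOrder Z := LinearLocallyFiniteOrder.succOrder Z
  let : PredOrder Z := LinearLocallyFiniteOrder.predOrder Z
  let e : Z ≃o ℤ := orderIsoIntOfLinearSuccPredArch
  refine ⟨fun i => (e.symm i : ℤ), fun i j h => e.symm.strictMono h, fun i => (e.symm i).2,
    fun m => ?_⟩
  obtain ⟨j, hj, hjm⟩ := hdown m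
  obtain ⟨b, ⟨hbZ, hbm⟩, hmax⟩ := Int.exists_greatest_of_bdd (P := fun k => k ∈ Z ∧ k ≤ m)
    ⟨m, fun k hk => hk.2⟩ ⟨j, hj, hjm.le⟩
  have hlt : b < (e.symm (e ⟨b, hbZ⟩ + 1) : ℤ) := by
    have : e.symm (e ⟨b, hbZ⟩) < e.symm (e ⟨b, hbZ⟩ + 1) := e.symm.strictMono (by omega)
    rw [e.symm_apply_apply] at this
    exact this
  refine ⟨e ⟨b, hbZ⟩, by simpa using hbm, ?_, fun k hk1 hk2 hkZ => ?_⟩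
  · by_contra hcon
    exact absurd (hmax _ ⟨(e.symm (e ⟨b, hbZ⟩ + 1)).2, by simpa using hcon⟩) (by simpa using hlt)
  · have h1 : (⟨b, hbZ⟩ : Z) < ⟨k, hkZ⟩ := by simpa using hk1
    have h2 : (⟨k, hkZ⟩ : Z) < e.symm (e ⟨b, hbZ⟩ + 1) := hk2
    have h1' := e.strictMono h1
    have h2' := e.strictMono h2
    rw [e.apply_symm_apply] at h2'
    omega

theorem mem_core_of_states (hS : ∀ v, free v → S v = Set.Ioi 0) {x : ℤ → V}
    {s : ℤ → RunState free} (hs : ∀ k, runStep free S (s k) (x k) = some (s (k + 1)))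
    (hup : ∀ k, ∃ j, k < j ∧ x (j - 1) ≠ x j) (hdown : ∀ k, ∃ j, j < k ∧ x (j - 1) ≠ x j) :
    x ∈ SGraphCore (HubAdj free) S := by
  obtain ⟨t, ht, htZ, hcov⟩ := exists_strictMono_enumeration (Z := {j | x (j - 1) ≠ x j})
    (fun k => by obtain ⟨j, h1, h2⟩ := hup k; exact ⟨j, h2, h1⟩)
    (fun k => by obtain ⟨j, h1, h2⟩ := hdown k; exact ⟨j, h2, h1⟩)
  have hgap : ∀ i k, t i < k → k < t (i + 1) → x (k - 1) = x k := by
    intro i k h1 h2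
    obtain ⟨i', h3, h4, h5⟩ := hcov (t i)
    have e : i' = i := by
      have := ht.le_iff_le.1 h3
      have := ht.lt_iff_lt.1 h4
      omega
    subst e
    by_contra hne
    exact h5 k h1 h2 hne
  have hconst : ∀ i (n : ℕ), t i + n < t (i + 1) → x (t i + n) = x (t i) := by
    intro i n
    induction n with
    | zero => simp
    | succ n ih =>
      intro hn
      push_cast at hn ⊢
      rw [← ih (by omega), ← hgap i (t i + (n + 1)) (by omega) hn]
      congr 1; ring
  have hconst' : ∀ i k, t i ≤ k → k < t (i + 1) → x k = x (t i) := by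
    intro i k h1 h2
    have := hconst i (k - t i).toNat (by omega)
    rwa [show t i + ((k - t i).toNat : ℤ) = k by omega] at this
  have hlast : ∀ k v m, s (k + 1) = some (v, m) → x k = v.1 := by
    intro k v m h
    have := hs k
    rw [h, runStep_eq_some_some] at this
    exact this.1
  have hfree : ∀ k, s (k + 1) = none → free (x k) := by
    intro k h
    have := hs k
    rw [h, runStep_eq_some_none] at this
    exact this.1
  have hlt : ∀ i, t i < t (i + 1) := fun i => ht (by omega)
  have hend : ∀ i, x (t (i + 1) - 1) = x (t i) := fun i =>
    hconst' i _ (by have := hlt i; omega) (by omega)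
  have hrun : ∀ i (h : ¬ free (x (t i))) (n : ℕ), t i + n < t (i + 1) →
      s (t i + n + 1) = some (⟨x (t i), h⟩, n) := by
    intro i h n
    induction n with
    | zero =>
      intro _
      simp only [Nat.cast_zero, add_zero]
      obtain hn | ⟨⟨v, m⟩, hv⟩ := Option.eq_none_or_eq_some (s (t i + 1))
      · exact absurd (hfree _ hn) h
      · have hx := hlast _ _ _ hv
        have h1 := hs (t i)
        rw [hv, runStep_eq_some_some] at h1
        obtain ⟨-, ⟨-, rfl⟩ | ⟨k, hk, -⟩⟩ := h1
        · rw [hv]; simp only [hx]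
        · have := hlast (t i - 1) v k (by rw [sub_add_cancel]; exact hk)
          exact absurd (this.trans hx.symm) (htZ i)
    | succ n ih =>
      intro hn
      push_cast at hn ⊢
      have h1 := hs (t i + n + 1)
      have hx := hconst' i (t i + n + 1) (by omega) (by omega)
      rw [ih (by omega), hx] at h1
      have h2 := runStep_self (S := S) ⟨x (t i), h⟩ n
      simp only at h2
      rw [h2] at h1
      rw [← add_assoc, ← Option.some.inj h1]
  refine ⟨fun i => x (t i), t, ht, fun i => ?_, fun i => ?_, hconst', fun m => ?_⟩
  · by_cases hf : free (x (t i))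
    · rw [hS _ hf]
      have := hlt i
      simp only [Set.mem_Ioi]; omega
    · have hl := hlt i
      obtain ⟨n, hn⟩ : ∃ n : ℕ, t (i + 1) = t i + n + 1 := ⟨(t (i + 1) - t i - 1).toNat, by omega⟩
      have h1 := hrun i hf n (by omega)
      rw [← hn] at h1
      have h2 := hs (t (i + 1))
      have h3 := htZ (i + 1)
      rw [Set.mem_ofPred_eq, hend] at h3
      rw [show (t (i + 1) - t i).toNat = n + 1 by omega]
      obtain hn | ⟨⟨v, m⟩, hv⟩ := Option.eq_none_or_eq_some (s (t (i + 1) + 1))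
      · rw [hn, runStep_eq_some_none] at h2
        exact h2.2 _ _ h1
      · rw [hv, runStep_eq_some_some, h1] at h2
        obtain ⟨h4, ⟨h5, -⟩ | ⟨k, hk, -⟩⟩ := h2
        · simp at h5
        · simp only [Option.some.injEq, Prod.mk.injEq] at hk
          rw [h4, ← hk.1] at h3
          exact absurd rfl h3
  · have h3 := htZ (i + 1)
    rw [Set.mem_ofPred_eq, hend] at h3
    refine ⟨h3, ?_⟩
    by_contra hcon
    push Not at hcon
    have h2 := hs (t (i + 1))
    obtain hn | ⟨⟨v, m⟩, hv⟩ := Option.eq_none_or_eq_some (s (t (i + 1)))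
    · refine hcon.1 (hend i ▸ hfree (t (i + 1) - 1) (by rw [sub_add_cancel]; exact hn))
    · have hx1 := hlast (t (i + 1) - 1) v m (by rw [sub_add_cancel]; exact hv)
      obtain hn' | ⟨⟨v', m'⟩, hv'⟩ := Option.eq_none_or_eq_some (s (t (i + 1) + 1))
      · exact hcon.2 (hfree _ hn')
      · rw [hv', runStep_eq_some_some, hv] at h2
        obtain ⟨h4, ⟨h5, -⟩ | ⟨k, hk, -⟩⟩ := h2
        · simp at h5
        · simp only [Option.some.injEq, Prod.mk.injEq] at hk
          rw [hend] at hx1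
          rw [h4, ← hk.1, hx1] at h3
          exact h3 rfl
  · obtain ⟨i, h1, h2, -⟩ := hcov m
    exact ⟨i, h1, h2⟩

end RunAutomaton

section RunAutomatonLanguage

variable {V : Type*} {free : V → Prop} {S : V → Set ℕ}

theorem foldlM_append_eq_some {σ : Type*} {step : σ → V → Option σ} {s s' s'' : σ} {u v : List V}
    (hu : u.foldlM step s = some s') (hv : v.foldlM step s' = some s'') :
    (u ++ v).foldlM step s = some s'' := by
  rw [List.foldlM_append, hu]
  exact hv

theorem exists_states_of_foldlM {σ : Type*} {step : σ → V → Option σ} :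
    ∀ (w : List V) {s s' : σ}, w.foldlM step s = some s' →
      ∃ f : ℕ → σ, f 0 = s ∧ f w.length = s' ∧
        ∀ j (hj : j < w.length), step (f j) w[j] = some (f (j + 1)) := by
  intro w
  induction w with
  | nil => intro s s' h; exact ⟨fun _ => s, rfl, by simpa using h, by simp⟩
  | cons a w ih =>
    intro s s' h
    rw [List.foldlM_cons] at h
    obtain hn | ⟨s1, h1⟩ := Option.eq_none_or_eq_some (step s a)
    · simp [hn] at h
    · rw [h1] at h
      obtain ⟨f, h0, hl, hf⟩ := ih h
      refine ⟨fun n => Nat.casesOn n s f, rfl, hl, ?_⟩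
      rintro (- | j) hj
      · simpa [h0] using h1
      · exact hf j (by simpa using hj)

theorem inLanguage_of_append_append {A : Type*} {X : Set (ℤ → A)} {u v w : List A}
    (h : InLanguage X (u ++ v ++ w)) : InLanguage X v := by
  obtain ⟨x, hx, k, hk⟩ := h
  refine ⟨x, hx, k + u.length, fun i => ?_⟩
  have hi := i.2
  have := hk ⟨u.length + i, by simp only [List.length_append]; omega⟩
  simp only [Nat.cast_add, List.get_eq_getElem] at this ⊢
  rw [add_assoc, this, List.getElem_append_left (by simp),
    List.getElem_append_right (by omega)]
  simp

theorem inLanguage_of_cycle (hS : ∀ v, free v → S v = Set.Ioi 0) {w : List V}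
    (hc : w.foldlM (runStep free S) none = some none) (hne : ∃ u ∈ w, ∃ v ∈ w, u ≠ v) :
    InLanguage (SGraphCore (HubAdj free) S) w := by
  obtain ⟨f, hf0, hfL, hf⟩ := exists_states_of_foldlM w hc
  obtain ⟨u, hu, v, hv, huv⟩ := hne
  have hL : 0 < w.length := List.length_pos_of_mem hu
  have hmod : ∀ k : ℤ, (k % w.length).toNat < w.length := fun k => by
    have := Int.emod_lt_of_pos k (Int.natCast_pos.2 hL)
    have := Int.emod_nonneg k (Int.natCast_pos.2 hL).ne'
    omega
  let x : ℤ → V := fun k => w[(k % w.length).toNat]'(hmod k)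
  have hxper : ∀ (j : ℕ) (hj : j < w.length) (n : ℤ), x (j + n * w.length) = w[j] := by
    intro j hj n
    simp only [x]
    congr 1
    rw [Int.add_mul_emod_self_right, Int.emod_eq_of_lt (by omega) (by omega)]
    simp
  have hocc : ∀ a ∈ w, ∀ k : ℤ, (∃ j, k < j ∧ x j = a) ∧ ∃ j, j < k ∧ x j = a := by
    intro a ha k
    obtain ⟨j, hj, rfl⟩ := List.getElem_of_mem ha
    have h1 : (1 : ℤ) ≤ w.length := by omega
    have h2 : |k| + 1 ≤ (|k| + 1) * w.length := le_mul_of_one_le_right (by positivity) h1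
    refine ⟨⟨_, ?_, hxper j hj (|k| + 1)⟩, ⟨_, ?_, hxper j hj (-(|k| + 1 + 1))⟩⟩
    · have := le_abs_self k; linarith
    · have := neg_abs_le k; nlinarith
  have hchange : ∀ i j, i ≤ j → x i ≠ x j → ∃ l, i < l ∧ l ≤ j ∧ x (l - 1) ≠ x l := by
    intro i j hij hne
    by_contra! hcon
    refine hne ?_
    clear hne
    induction j, hij using Int.leInduction with
    | base => rfl
    | succ j hij ih =>
      rw [ih fun l h1 h2 => hcon l h1 (by omega)]
      simpa using hcon (j + 1) (by omega) le_rfl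
  refine ⟨x, mem_core_of_states (s := fun k => f (k % w.length).toNat) hS (fun k => ?_)
    (fun k => ?_) (fun k => ?_), 0, fun i => ?_⟩
  · have h1 := hf _ (hmod k)
    simp only [x]
    rw [h1]
    congr 1
    have h2 := Int.emod_nonneg k (Int.natCast_pos.2 hL).ne'
    have h3 := Int.emod_lt_of_pos k (Int.natCast_pos.2 hL)
    have h4 : (k + 1) % (w.length : ℤ) = (k % w.length + 1) % w.length :=
      (Int.emod_add_emod _ _ _).symm
    rw [h4]
    by_cases h : k % w.length + 1 = w.length
    · rw [h, Int.emod_self, show (k % w.length).toNat + 1 = w.length by omega, hfL]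
      exact hf0.symm
    · rw [Int.emod_eq_of_lt (a := k % w.length + 1) (by omega) (by omega)]
      congr 1; omega
  · obtain ⟨i, hi, hxi⟩ := (hocc u hu k).1
    obtain ⟨j, hj, hxj⟩ := (hocc v hv i).1
    obtain ⟨l, h1, h2, h3⟩ := hchange i j hj.le (by rw [hxi, hxj]; exact huv)
    exact ⟨l, by omega, h3⟩
  · obtain ⟨j, hj, hxj⟩ := (hocc v hv k).2
    obtain ⟨i, hi, hxi⟩ := (hocc u hu j).2
    obtain ⟨l, h1, h2, h3⟩ := hchange i j hi.le (by rw [hxi, hxj]; exact huv)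
    exact ⟨l, by omega, h3⟩
  · have := hxper i i.2 0
    simpa using this

/-- Every set `S v` with `v` non-free has gaps at most `G`. -/
def RunSyndetic (free : V → Prop) (S : V → Set ℕ) (G : ℕ) : Prop :=
  ∀ v, ¬ free v → ∀ m, ∃ j ≤ G, m + 1 + j ∈ S v

theorem foldlM_replicate_self (v : {v // ¬ free v}) (n : ℕ) :
    ∀ m, (List.replicate n v.1).foldlM (runStep free S) (some (v, m)) = some (some (v, m + n)) := by
  induction n with
  | zero => intro m; simp
  | succ n ih =>
    intro m
    rw [List.replicate_succ, List.foldlM_cons, runStep_self]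
    simp only [Option.bind_eq_bind, Option.bind_some, ih]
    congr 3; ring

theorem foldlM_replicate_free {b : V} (hb : free b) (n : ℕ) :
    (List.replicate n b).foldlM (runStep free S) none = some none := by
  induction n with
  | zero => simp
  | succ n ih =>
    rw [List.replicate_succ, List.foldlM_cons, runStep_none_free hb]
    exact ih

theorem foldlM_replicate_succ (v : {v // ¬ free v}) (n : ℕ) :
    (List.replicate (n + 1) v.1).foldlM (runStep free S) none = some (some (v, n)) := by
  rw [List.replicate_succ, List.foldlM_cons, runStep_none_notFree]
  simp only [Option.bind_eq_bind, Option.bind_some, foldlM_replicate_self, zero_add]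

theorem exists_word_to_state (s : RunState free) :
    ∃ u : List V, u.foldlM (runStep free S) none = some s := by
  obtain - | ⟨v, m⟩ := s
  · exact ⟨[], rfl⟩
  · exact ⟨_, foldlM_replicate_succ v m⟩

theorem foldlM_singleton_eq {σ : Type*} {step : σ → V → Option σ} {s s' : σ} {a : V}
    (h : step s a = some s') : [a].foldlM step s = some s' := by
  simp [h]

theorem RunSyndetic.exists_completion {G : ℕ} (hG : RunSyndetic free S G) {b : V} (hb : free b)
    (s : RunState free) :
    ∃ r : List V, r.length ≤ G + 1 ∧ r.foldlM (runStep free S) s = some none := by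
  obtain - | ⟨v, m⟩ := s
  · exact ⟨[], by simp, rfl⟩
  · obtain ⟨j, hj, hmem⟩ := hG v.1 v.2 m
    refine ⟨List.replicate j v.1 ++ [b], by simpa using hj,
      foldlM_append_eq_some (foldlM_replicate_self v j m) (foldlM_singleton_eq ?_)⟩
    exact runStep_some_free hb (by rwa [add_right_comm] at hmem)

theorem RunSyndetic.exists_cycle {G : ℕ} (hG : RunSyndetic free S G) {b : V} (hb : free b)
    {v : V} (hv : ¬ free v) :
    ∃ c : List V, b ∈ c ∧ v ∈ c ∧ c.foldlM (runStep free S) none = some none := by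
  obtain ⟨r, -, hr⟩ := hG.exists_completion hb (some (⟨v, hv⟩, 0))
  exact ⟨[b] ++ ([v] ++ r), by simp, by simp,
    foldlM_append_eq_some (foldlM_singleton_eq (runStep_none_free hb))
      (foldlM_append_eq_some (foldlM_singleton_eq (runStep_none_notFree ⟨v, hv⟩)) hr)⟩

theorem inLanguage_core_iff (hS : ∀ v, free v → S v = Set.Ioi 0) {G : ℕ}
    (hG : RunSyndetic free S G) {b : V} (hb : free b) {v : V} (hv : ¬ free v) {w : List V} :
    InLanguage (SGraphCore (HubAdj free) S) w ↔
      ∃ s s', w.foldlM (runStep free S) s = some s' := by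
  constructor
  · rintro ⟨x, hx, k, hk⟩
    obtain ⟨s, hs⟩ := exists_states_of_mem_core hx
    exact ⟨_, _, foldlM_window hs w k hk⟩
  · rintro ⟨s, s', h⟩
    obtain ⟨u, hu⟩ := exists_word_to_state (S := S) s
    obtain ⟨r, -, hr⟩ := hG.exists_completion hb s'
    obtain ⟨c, hbc, hvc, hc⟩ := hG.exists_cycle hb hv
    refine inLanguage_of_append_append (u := u) (w := r ++ c) (inLanguage_of_cycle hS
      (foldlM_append_eq_some (foldlM_append_eq_some hu h) (foldlM_append_eq_some hr hc))
      ⟨b, by simp [hbc], v, by simp [hvc], fun e => hv (e ▸ hb)⟩)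

theorem RunSyndetic.exists_short_run {G : ℕ} (hG : RunSyndetic free S G) (v : {v // ¬ free v}) :
    ∀ (w : List V) (j m : ℕ) (s : RunState free),
      w.foldlM (runStep free S) (some (v, m + j)) = some s →
      ∃ m' ≤ G, ∃ s', w.foldlM (runStep free S) (some (v, m' + j)) = some s' := by
  intro w
  induction w with
  | nil => intro j m s _; exact ⟨0, by simp, _, rfl⟩
  | cons a w ih =>
    intro j m s h
    rw [List.foldlM_cons] at h
    obtain hn | ⟨s1, h1⟩ := Option.eq_none_or_eq_some (runStep free S (some (v, m + j)) a)
    · simp [hn] at h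
    · rw [h1] at h
      obtain - | ⟨v', m'⟩ := s1
      · obtain ⟨hfree, -⟩ := runStep_eq_some_none.1 h1
        obtain ⟨m', hm', hmem⟩ := hG v.1 v.2 j
        refine ⟨m', hm', s, ?_⟩
        rw [List.foldlM_cons, runStep_some_free hfree
          (by rwa [show m' + j + 1 = j + 1 + m' by ring])]
        exact h
      · obtain ⟨rfl, ⟨h2, -⟩ | ⟨k, h2, rfl⟩⟩ := runStep_eq_some_some.1 h1
        · simp at h2
        · obtain ⟨rfl, rfl⟩ := Prod.mk.inj (Option.some.inj h2)
          obtain ⟨m', hm', s', h'⟩ := ih (j + 1) m s h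
          refine ⟨m', hm', s', ?_⟩
          rw [List.foldlM_cons, runStep_self]
          exact h'

/-- The states whose current run, if any, has length at most `G + 1`. -/
def shortStates (free : V → Prop) (G : ℕ) : Set (RunState free) :=
  {s | ∀ v m, s = some (v, m) → m ≤ G}

theorem finite_shortStates [Finite V] (G : ℕ) : (shortStates free G).Finite := by
  have : shortStates free G ⊆ insert none (some '' (Set.univ ×ˢ Set.Iic G)) := by
    rintro (- | ⟨v, m⟩) h
    · exact Set.mem_insert _ _
    · exact .inr ⟨(v, m), ⟨trivial, h v m rfl⟩, rfl⟩
  exact (((Set.finite_univ.prod (Set.finite_Iic G)).image _).insert _).subset this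

theorem RunSyndetic.exists_shortState {G : ℕ} (hG : RunSyndetic free S G) {w : List V}
    {s s' : RunState free} (h : w.foldlM (runStep free S) s = some s') :
    ∃ s₁ ∈ shortStates free G, ∃ s₂, w.foldlM (runStep free S) s₁ = some s₂ := by
  obtain - | ⟨v, m⟩ := s
  · exact ⟨none, fun _ _ h => by simp at h, s', h⟩
  · obtain ⟨m', hm', s₂, h₂⟩ := hG.exists_short_run v w 0 m s' h
    refine ⟨some (v, m'), ?_, s₂, h₂⟩
    rintro _ _ ⟨⟩
    exact hm'

theorem hasSpecification_of_runSyndetic [TopologicalSpace V] [DiscreteTopology V]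
    (hS : ∀ v, free v → S v = Set.Ioi 0) {G : ℕ}
    (hG : RunSyndetic free S G) {b : V} (hb : free b) {v : V} (hv : ¬ free v) :
    HasSpecification (closure (SGraphCore (HubAdj free) S)) := by
  refine ⟨(G + 1) + (G + 1), fun α β hα hβ => ?_⟩
  simp only [inLanguage_closure_iff, inLanguage_core_iff hS hG hb hv] at hα hβ ⊢
  obtain ⟨s, s', hα⟩ := hα
  obtain ⟨_, _, hβ⟩ := hβ
  obtain ⟨s₁, hs₁, s₂, hβ⟩ := hG.exists_shortState hβ
  obtain ⟨r, hrl, hr⟩ := hG.exists_completion hb s'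
  obtain ⟨u, hul, hu⟩ : ∃ u : List V, u.length ≤ G + 1 ∧
      u.foldlM (runStep free S) none = some s₁ := by
    obtain - | ⟨v, m⟩ := s₁
    · exact ⟨[], by simp, rfl⟩
    · exact ⟨_, by simpa using hs₁ v m rfl, foldlM_replicate_succ v m⟩
  refine ⟨r ++ (List.replicate ((G + 1) + (G + 1) - r.length - u.length) b ++ u), ?_, s, s₂, ?_⟩
  · simp only [List.length_append, List.length_replicate]; omega
  · exact foldlM_append_eq_some (foldlM_append_eq_some hα (foldlM_append_eq_some hr
      (foldlM_append_eq_some (foldlM_replicate_free hb _) hu))) hβ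

theorem mem_iff_inLanguage (hS : ∀ v, free v → S v = Set.Ioi 0) {G : ℕ}
    (hG : RunSyndetic free S G) {b : V} (hb : free b) {v : V} (hv : ¬ free v) (n : ℕ) :
    InLanguage (SGraphCore (HubAdj free) S) ([b] ++ (List.replicate (n + 1) v ++ [b])) ↔
      n + 1 ∈ S v := by
  rw [inLanguage_core_iff hS hG hb hv]
  constructor
  · rintro ⟨s, s', h⟩
    rw [List.foldlM_append] at h
    obtain hn | ⟨s1, h1⟩ := Option.eq_none_or_eq_some ([b].foldlM (runStep free S) s)
    · simp [hn] at h
    · rw [h1] at h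
      have e : s1 = none := by
        have h2 : runStep free S s b = some s1 := by simpa using h1
        obtain - | ⟨v', m'⟩ := s1
        · rfl
        · exact absurd ((runStep_eq_some_some.1 h2).1 ▸ hb) v'.2
      subst e
      simp only [Option.bind_eq_bind, Option.bind_some] at h
      rw [List.foldlM_append, foldlM_replicate_succ ⟨v, hv⟩ n] at h
      have h2 : runStep free S (some (⟨v, hv⟩, n)) b = some s' := by simpa using h
      obtain - | ⟨v', m'⟩ := s'
      · exact (runStep_eq_some_none.1 h2).2 _ _ rfl
      · exact absurd ((runStep_eq_some_some.1 h2).1 ▸ hb) v'.2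
  · intro h
    exact ⟨none, none, foldlM_append_eq_some (foldlM_singleton_eq (runStep_none_free hb))
      (foldlM_append_eq_some (foldlM_replicate_succ ⟨v, hv⟩ n)
        (foldlM_singleton_eq (runStep_some_free hb h)))⟩

end RunAutomatonLanguage

section Weights

open Classical in
/-- The sum of `r ^ (k - m)` over the elements `k > m` of `A`. -/
noncomputable def tailSum (A : Set ℕ) (r : ℝ) (m : ℕ) : ℝ :=
  ∑' j : ℕ, if m + 1 + j ∈ A then r ^ (j + 1) else 0

variable {r : ℝ}

theorem hasSum_geometric_succ (h0 : 0 ≤ r) (h1 : r < 1) :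
    HasSum (fun j : ℕ => r ^ (j + 1)) (r * (1 - r)⁻¹) := by
  simpa [pow_succ'] using (hasSum_geometric_of_lt_one h0 h1).mul_left r

open Classical in
theorem summable_ite_pow (h0 : 0 ≤ r) (h1 : r < 1) (P : ℕ → Prop) :
    Summable fun j : ℕ => if P j then r ^ (j + 1) else 0 := by
  refine (hasSum_geometric_succ h0 h1).summable.of_nonneg_of_le (fun j => ?_) fun j => ?_ <;>
    split_ifs <;> first | rfl | positivity

open Classical in
theorem tailSum_eq (h0 : 0 ≤ r) (h1 : r < 1) (A : Set ℕ) (m : ℕ) :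
    tailSum A r m = (if m + 1 ∈ A then r else 0) + r * tailSum A r (m + 1) := by
  rw [tailSum, (summable_ite_pow h0 h1 _).tsum_eq_zero_add, tailSum, ← tsum_mul_left]
  congr 1
  · simp
  · refine tsum_congr fun j => ?_
    rw [mul_ite, mul_zero, pow_succ' r (j + 1), show m + 1 + (j + 1) = m + 1 + 1 + j by ring]

theorem tailSum_le (h0 : 0 ≤ r) (h1 : r < 1) (A : Set ℕ) (m : ℕ) :
    tailSum A r m ≤ r * (1 - r)⁻¹ := by
  rw [← (hasSum_geometric_succ h0 h1).tsum_eq]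
  refine (summable_ite_pow h0 h1 _).tsum_le_tsum (fun j => ?_)
    (hasSum_geometric_succ h0 h1).summable
  split_ifs <;> first | rfl | positivity

theorem le_tailSum (h0 : 0 ≤ r) (h1 : r < 1) {A : Set ℕ} {m j : ℕ} (hj : m + 1 + j ∈ A) :
    r ^ (j + 1) ≤ tailSum A r m := by
  classical
  have := (summable_ite_pow h0 h1 (fun j => m + 1 + j ∈ A)).le_tsum j
    (fun i _ => by split_ifs <;> first | rfl | positivity)
  rw [if_pos hj] at this
  rw [tailSum]
  exact this

end Weights

section RunEntropy

variable {V : Type*} {free : V → Prop} {S : V → Set ℕ}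

theorem hasEntropy_of_runSyndetic [TopologicalSpace V] [DiscreteTopology V] [Fintype V]
    [DecidablePred free] (hS : ∀ v, free v → S v = Set.Ioi 0) {G : ℕ}
    (hG : RunSyndetic free S G) {b : V} (hb : free b) {v : V} (hv : ¬ free v) {lam : ℝ}
    (hlam : 1 < lam)
    (hsum : (Fintype.card {v // free v} : ℝ) +
      Fintype.card {v // free v} * ∑ u : {v // ¬ free v}, tailSum (S u) lam⁻¹ 0 = lam) :
    HasEntropy (closure (SGraphCore (HubAdj free) S)) (Real.log lam) := by
  classical
  set q := Fintype.card {v // free v} with hq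
  have hqpos : 1 ≤ q := Fintype.card_pos_iff.2 ⟨⟨b, hb⟩⟩
  have hq1 : (1 : ℝ) ≤ q := by exact_mod_cast hqpos
  have hlam0 : 0 < lam := by linarith
  have hr0 : 0 < lam⁻¹ := by positivity
  have hr1 : lam⁻¹ < 1 := inv_lt_one_of_one_lt₀ hlam
  let wt : RunState free → ℝ
    | none => 1
    | some (v, m) => q * tailSum (S v) lam⁻¹ m
  set c : ℝ := min 1 (lam⁻¹ ^ (G + 1)) with hc
  set C : ℝ := max 1 (q * (lam⁻¹ * (1 - lam⁻¹)⁻¹)) with hC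
  have hcpos : 0 < c := lt_min one_pos (by positivity)
  have hCpos : 0 < C := lt_max_of_lt_left one_pos
  have hwt : ∀ s, c ≤ wt s ∧ wt s ≤ C := by
    rintro (- | ⟨u, m⟩)
    · exact ⟨min_le_left _ _, le_max_left _ _⟩
    · obtain ⟨j, hj, hmem⟩ := hG u.1 u.2 m
      refine ⟨(min_le_right _ _).trans ?_, le_trans ?_ (le_max_right _ _)⟩
      · calc lam⁻¹ ^ (G + 1) ≤ lam⁻¹ ^ (j + 1) :=
              pow_le_pow_of_le_one hr0.le hr1.le (by omega)
          _ ≤ tailSum (S u) lam⁻¹ m := le_tailSum hr0.le hr1 hmem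
          _ ≤ q * tailSum (S u) lam⁻¹ m := le_mul_of_one_le_left
              ((by positivity : (0 : ℝ) ≤ lam⁻¹ ^ (j + 1)).trans
                (le_tailSum hr0.le hr1 hmem)) hq1
      · exact mul_le_mul_of_nonneg_left (tailSum_le hr0.le hr1 _ _) (by positivity)
  have hsplit : ∀ g : V → ℝ, ∑ a, g a = ∑ a : {v // free v}, g a + ∑ a : {v // ¬ free v}, g a :=
    fun g => (Fintype.sum_subtype_add_sum_subtype free g).symm
  have heig : ∀ s, ∑ a, (runStep free S s a).elim 0 wt = lam * wt s := by
    rintro (- | ⟨u, m⟩)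
    · rw [hsplit]
      have h1 : ∀ a : {v // free v}, (runStep free S none a.1).elim 0 wt = 1 := fun a => by
        rw [runStep_none_free a.2]; rfl
      have h2 : ∀ a : {v // ¬ free v}, (runStep free S none a.1).elim 0 wt =
          q * tailSum (S a) lam⁻¹ 0 := fun a => by
        rw [runStep_none_notFree a]; rfl
      simp only [h1, h2, ← Finset.mul_sum, Finset.sum_const, Finset.card_univ, nsmul_eq_mul,
        mul_one]
      rw [← hq, hsum]
      simp [wt]
    · rw [hsplit]
      have h1 : ∀ a : {v // free v}, (runStep free S (some (u, m)) a.1).elim 0 wt =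
          if m + 1 ∈ S u.1 then 1 else 0 := fun a => by
        have : a.1 ≠ u.1 := fun e => u.2 (e ▸ a.2)
        simp only [runStep, this, a.2, if_false, true_and]
        split_ifs <;> rfl
      have h2 : ∀ a : {v // ¬ free v}, (runStep free S (some (u, m)) a.1).elim 0 wt =
          if a = u then q * tailSum (S u) lam⁻¹ (m + 1) else 0 := fun a => by
        simp only [runStep, Subtype.ext_iff, a.2, false_and, if_false]
        split_ifs <;> rfl
      simp only [h1, h2, Finset.sum_const, Finset.card_univ, nsmul_eq_mul, Finset.sum_ite_eq',
        Finset.mem_univ, if_true]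
      simp only [wt]
      rw [tailSum_eq hr0.le hr1 (S u) m, ← hq]
      split_ifs <;> field_simp
      simp
  have hbounds := ncard_readableWords_bounds (runStep free S) hcpos hCpos wt hwt heig
  have hlang : ∀ w, InLanguage (closure (SGraphCore (HubAdj free) S)) w ↔
      ∃ s s', w.foldlM (runStep free S) s = some s' := fun w => by
    rw [inLanguage_closure_iff, inLanguage_core_iff hS hG hb hv]
  have hfinlang : ∀ n, {w : List V | w.length = n ∧
      InLanguage (closure (SGraphCore (HubAdj free) S)) w}.Finite := fun n =>
    (List.finite_length_eq V n).subset fun _ h => h.1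
  set F := (finite_shortStates (free := free) G).toFinset
  refine hasEntropy_of_bounds (c := 1 / C) (C := F.card * (C / c)) hlam0 (by positivity)
    (fun n => ?_) fun n => ?_
  · have h1 := (hbounds n none).1
    have h2 : (readableWords (runStep free S) n none).ncard ≤
        {w : List V | w.length = n ∧ InLanguage (closure (SGraphCore (HubAdj free) S)) w}.ncard :=
      Set.ncard_le_ncard (fun w hw => ⟨hw.1, (hlang w).2 ⟨none, Option.isSome_iff_exists.1 hw.2⟩⟩)
        (hfinlang n)
    refine le_trans (le_of_eq ?_) (h1.trans (Nat.cast_le.2 h2))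
    simp only [wt]; ring
  · have hsub : {w : List V | w.length = n ∧
        InLanguage (closure (SGraphCore (HubAdj free) S)) w} ⊆
        ⋃ s ∈ F, readableWords (runStep free S) n s := by
      rintro w ⟨hl, hw⟩
      obtain ⟨s, s', h⟩ := (hlang w).1 hw
      obtain ⟨s₁, hs₁, s₂, h⟩ := hG.exists_shortState h
      simp only [Set.mem_iUnion]
      exact ⟨s₁, by simpa [F] using hs₁, hl, by simp [h]⟩
    have h1 := (Set.ncard_le_ncard hsub (F.finite_toSet.biUnion fun s _ =>
      finite_readableWords _ _ _)).trans (F.set_ncard_biUnion_le _)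
    calc (_ : ℝ) ≤ ((∑ s ∈ F, (readableWords (runStep free S) n s).ncard : ℕ) : ℝ) :=
          Nat.cast_le.2 h1
      _ ≤ ∑ s ∈ F, C / c * lam ^ n := by
          push_cast
          refine Finset.sum_le_sum fun s _ => (hbounds n s).2.trans ?_
          rw [div_mul_eq_mul_div, mul_comm C]
          have := (hwt s).2
          gcongr
      _ = F.card * (C / c) * lam ^ n := by
          rw [Finset.sum_const, nsmul_eq_mul, mul_assoc]

end RunEntropy

section Expansions

/-- Expansions in a real base `lam ≤ q + 1` with digits at most `q`. -/
theorem exists_digits {lam : ℝ} {q : ℕ} (hlam : 1 < lam) (hq : lam ≤ q + 1) {y : ℝ}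
    (hy0 : 0 ≤ y) (hy1 : y ≤ q / (lam - 1)) :
    ∃ d : ℕ → ℕ, (∀ n, d n ≤ q) ∧ HasSum (fun n => (d n : ℝ) * lam⁻¹ ^ (n + 1)) y := by
  let digit : ℝ → ℕ := fun z => min q ⌊lam * z⌋₊
  let rem : ℕ → ℝ := fun n => Nat.rec y (fun _ z => lam * z - digit z) n
  have hlam0 : 0 < lam := by linarith
  have hrem : ∀ n, 0 ≤ rem n ∧ rem n ≤ q / (lam - 1) := by
    intro n
    induction n with
    | zero => exact ⟨hy0, hy1⟩
    | succ n ih =>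
      obtain ⟨h0, h1⟩ := ih
      change 0 ≤ lam * rem n - digit (rem n) ∧ lam * rem n - digit (rem n) ≤ q / (lam - 1)
      have hnn : 0 ≤ lam * rem n := by positivity
      have hfl := Nat.floor_le hnn
      refine ⟨?_, ?_⟩
      · have : (digit (rem n) : ℝ) ≤ (⌊lam * rem n⌋₊ : ℝ) := Nat.cast_le.2 (min_le_right _ _)
        linarith
      · rcases le_total q ⌊lam * rem n⌋₊ with h | h
        · have e : digit (rem n) = q := min_eq_left h
          rw [e]
          have h2 := mul_le_mul_of_nonneg_left h1 hlam0.le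
          have h3 : lam * (q / (lam - 1)) - q = q / (lam - 1) := by
            have : lam - 1 ≠ 0 := by linarith
            field_simp; ring
          linarith
        · have e : digit (rem n) = ⌊lam * rem n⌋₊ := min_eq_right h
          rw [e]
          have h2 := Nat.lt_floor_add_one (lam * rem n)
          have h3 : 1 ≤ (q : ℝ) / (lam - 1) := by
            rw [le_div_iff₀ (by linarith)]; linarith
          linarith
  have hpartial : ∀ n, ∑ k ∈ Finset.range n, (digit (rem k) : ℝ) * lam⁻¹ ^ (k + 1) =
      y - rem n * lam⁻¹ ^ n := by
    intro n
    induction n with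
    | zero => simp [rem]
    | succ n ih =>
      rw [Finset.sum_range_succ, ih]
      change _ = y - (lam * rem n - digit (rem n)) * lam⁻¹ ^ (n + 1)
      rw [pow_succ]
      field_simp
      ring
  refine ⟨fun n => digit (rem n), fun n => min_le_left _ _, ?_⟩
  rw [hasSum_iff_tendsto_nat_of_nonneg (fun n => by positivity)]
  simp only [hpartial]
  have hpow : Tendsto (fun n : ℕ => lam⁻¹ ^ n) atTop (𝓝 0) :=
    tendsto_pow_atTop_nhds_zero_of_lt_one (by positivity) (inv_lt_one_of_one_lt₀ hlam)
  have hz : Tendsto (fun n => rem n * lam⁻¹ ^ n) atTop (𝓝 0) := by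
    refine squeeze_zero (fun n => mul_nonneg (hrem n).1 (by positivity))
      (fun n => mul_le_mul_of_nonneg_right (hrem n).2 (by positivity)) ?_
    simpa using hpow.const_mul (q / (lam - 1))
  simpa using hz.const_sub y

theorem exists_injective_family_of_syndetic_sets {ι : Type*} [Fintype ι] {lam : ℝ} {q : ℕ}
    (hlam : 1 < lam) (hq : lam ≤ q + 1) (hι : q + 1 ≤ Fintype.card ι) {x : ℝ} (hx0 : 0 < x)
    (hx1 : x ≤ q / (lam - 1)) :
    ∃ (G : ℕ) (S : Set ℕ → ι → Set ℕ), Function.Injective S ∧ ∀ E,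
      (∀ v, 0 ∉ S E v) ∧ (∀ v m, ∃ j ≤ G, m + 1 + j ∈ S E v) ∧
        ∑ v, tailSum (S E v) lam⁻¹ 0 = x := by
  classical
  have hr0 : 0 < lam⁻¹ := by positivity
  have hr1 : lam⁻¹ < 1 := inv_lt_one_of_one_lt₀ hlam
  set T := Fintype.card ι with hT
  have hTpos : 0 < T := by omega
  let e : Fin T ≃ ι := (Fintype.equivFin ι).symm
  let marked : ℕ → ι := fun n => e ⟨n / 2 % T, Nat.mod_lt _ hTpos⟩
  obtain ⟨N, hN⟩ : ∃ N : ℕ, lam⁻¹ ^ N * (lam⁻¹ * (1 - lam⁻¹)⁻¹) ≤ x := by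
    have hlim : Tendsto (fun n : ℕ => lam⁻¹ ^ n * (lam⁻¹ * (1 - lam⁻¹)⁻¹)) atTop (𝓝 0) := by
      simpa using (tendsto_pow_atTop_nhds_zero_of_lt_one hr0.le hr1).mul_const
        (lam⁻¹ * (1 - lam⁻¹)⁻¹)
    exact (hlim.eventually_le_const hx0).exists
  obtain ⟨R, hR⟩ : ∃ R : Set ℕ → ℕ → Prop, ∀ E n,
      R E n ↔ N ≤ n ∧ (Even n ∨ ∃ k ∈ E, n = 2 * (N + k) + 1) := ⟨_, fun _ _ => Iff.rfl⟩
  have hdig : ∀ E, ∃ d : ℕ → ℕ, (∀ n, d n ≤ q) ∧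
      HasSum (fun n => (d n : ℝ) * lam⁻¹ ^ (n + 1))
        (x - ∑' n, if R E n then lam⁻¹ ^ (n + 1) else 0) := by
    intro E
    have hnonneg : 0 ≤ ∑' n, if R E n then lam⁻¹ ^ (n + 1) else 0 :=
      tsum_nonneg fun n => by split_ifs <;> positivity
    refine exists_digits hlam hq ?_ (by linarith)
    refine sub_nonneg.2 (le_trans ?_ hN)
    have hs := summable_ite_pow hr0.le hr1 (R E)
    rw [← hs.sum_add_tsum_nat_add N, Finset.sum_eq_zero, zero_add,
      ← (hasSum_geometric_succ hr0.le hr1).tsum_eq, ← tsum_mul_left]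
    · refine ((summable_nat_add_iff N).2 hs).tsum_le_tsum (fun n => ?_)
        ((hasSum_geometric_succ hr0.le hr1).summable.mul_left _)
      split_ifs
      · rw [← pow_add]; exact le_of_eq (by congr 1; ring)
      · positivity
    · intro n hn
      rw [if_neg]
      intro h
      replace h := ((hR _ _).1 h).1
      simp only [Finset.mem_range] at hn
      omega
  choose d hd hdsum using hdig
  have hD : ∀ E n, ∃ D : Finset ι, D ⊆ Finset.univ.erase (marked n) ∧ D.card = d E n := by
    intro E n
    refine Finset.exists_subset_card_eq ?_
    rw [Finset.card_erase_of_mem (Finset.mem_univ _), Finset.card_univ]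
    have := hd E n
    omega
  choose D hDsub hDcard using hD
  have hDmarked : ∀ E n, marked n ∉ D E n := fun E n h => by simpa using hDsub E n h
  let S : Set ℕ → ι → Set ℕ := fun E v =>
    {m | ∃ n, m = n + 1 ∧ (v = marked n ∧ R E n ∨ v ∈ D E n)}
  have hmemS : ∀ E v n, n + 1 ∈ S E v ↔ (v = marked n ∧ R E n ∨ v ∈ D E n) := fun E v n => by
    constructor
    · rintro ⟨k, hk, h⟩
      obtain rfl : n = k := by omega
      exact h
    · exact fun h => ⟨n, rfl, h⟩
  refine ⟨N + 4 * T, S, fun E E' h => ?_, fun E => ⟨?_, fun v m => ?_, ?_⟩⟩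
  · have key : ∀ E k, k ∈ E ↔
        2 * (N + k) + 1 + 1 ∈ S E (marked (2 * (N + k) + 1)) := fun E k => by
      rw [hmemS, or_iff_left (hDmarked _ _), hR]
      constructor
      · exact fun hk => ⟨rfl, by omega, .inr ⟨k, hk, rfl⟩⟩
      · rintro ⟨-, -, h | ⟨k', hk', h⟩⟩
        · rw [Nat.even_iff] at h; omega
        · obtain rfl : k = k' := by omega
          exact hk'
    ext k
    rw [key E, key E', h]
  · rintro v ⟨n, h, -⟩
    omega
  · set t := e.symm v with ht
    have htlt := t.2
    set k := (m + N) / (2 * T) + 1 with hk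
    have h1 := Nat.div_add_mod (m + N) (2 * T)
    have h2 := Nat.mod_lt (m + N) (show 0 < 2 * T by omega)
    have h3 : 2 * T * k = 2 * T * ((m + N) / (2 * T)) + 2 * T := by rw [hk]; ring
    have h4 : 2 * (T * k + t) = 2 * T * k + 2 * t := by ring
    refine ⟨2 * (T * k + t) - m, by omega, ?_⟩
    rw [show m + 1 + (2 * (T * k + t) - m) = 2 * (T * k + t) + 1 by omega, hmemS]
    refine .inl ⟨?_, (hR _ _).2 ⟨by omega, .inl (even_two_mul _)⟩⟩
    rw [← Equiv.symm_apply_eq, ← ht]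
    ext
    simp only
    rw [Nat.mul_div_cancel_left _ (by norm_num), Nat.mul_add_mod, Nat.mod_eq_of_lt htlt]
  · have hcount : ∀ n, ∑ v, (if 0 + 1 + n ∈ S E v then lam⁻¹ ^ (n + 1) else 0) =
        (if R E n then lam⁻¹ ^ (n + 1) else 0) + d E n * lam⁻¹ ^ (n + 1) := by
      intro n
      have : ∀ v, (if 0 + 1 + n ∈ S E v then lam⁻¹ ^ (n + 1) else 0) =
          (if v = marked n then (if R E n then lam⁻¹ ^ (n + 1) else 0) else 0) +
            if v ∈ D E n then lam⁻¹ ^ (n + 1) else 0 := by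
        intro v
        rw [show 0 + 1 + n = n + 1 by ring]
        simp only [hmemS]
        by_cases hv : v = marked n
        · subst hv
          simp [hDmarked E n]
        · simp [hv]
      simp only [this, Finset.sum_add_distrib, Finset.sum_ite_eq', Finset.mem_univ, if_true,
        Finset.sum_ite_mem, Finset.univ_inter, Finset.sum_const, hDcard, nsmul_eq_mul]
    simp only [tailSum]
    rw [← Summable.tsum_finsetSum fun v _ => summable_ite_pow hr0.le hr1 _]
    simp only [hcount]
    rw [(summable_ite_pow hr0.le hr1 _).tsum_add (hdsum E).summable, (hdsum E).tsum_eq]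
    ring

end Expansions

/-- **Abundance of S-graph shifts of any entropy.**  Let `λ > 1`.  For every
`p ≥ 2⌈λ⌉ − 1` there are uncountably many pairwise non-conjugate `S`-graph
shifts on `p` vertices that have the specification property and entropy
`log λ`. -/
theorem uncountably_many_SGraphShifts (lam : ℝ) (hlam : 1 < lam)
    (p : ℕ) (hp : 2 * ⌈lam⌉ - 1 ≤ (p : ℤ)) :
    ∃ 𝒜 : Set (Set (ℤ → Fin p)),
      ¬ 𝒜.Countable ∧
      (∀ X ∈ 𝒜,
        (∃ (Adj : Fin p → Fin p → Prop) (S : Fin p → Set ℕ),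
          (∀ v, ¬ Adj v v) ∧ (∀ v, (S v).Nonempty) ∧ (∀ v, 0 ∉ S v) ∧
          X = closure (SGraphCore Adj S)) ∧
        HasSpecification X ∧ HasEntropy X (Real.log lam)) ∧
      𝒜.Pairwise fun X Y => ¬ Conjugate X Y := by
  have hone : 1 < ⌈lam⌉ := Int.lt_ceil.2 (by simpa using hlam)
  obtain ⟨q, hqc⟩ : ∃ q : ℕ, (q : ℤ) = ⌈lam⌉ - 1 :=
    ⟨(⌈lam⌉ - 1).toNat, Int.toNat_of_nonneg (by omega)⟩
  have hceil : (⌈lam⌉ : ℝ) = q + 1 := by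
    have : ⌈lam⌉ = (q : ℤ) + 1 := by omega
    rw [this]; push_cast; rfl
  have hq1 : 1 ≤ q := by omega
  have hpq : 2 * q + 1 ≤ p := by omega
  have hle : lam ≤ q + 1 := hceil ▸ Int.le_ceil lam
  have hlt : (q : ℝ) < lam := by have := Int.ceil_lt_add_one lam; linarith
  have hq0 : (1 : ℝ) ≤ q := by exact_mod_cast hq1
  let free : Fin p → Prop := fun v => v.val < q
  have : DecidablePred free := fun v => Nat.decLt _ _
  have hcard : Fintype.card {v // free v} = q := by
    have h := Fin.card_filter_val_lt (n := p) (m := q)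
    rw [min_eq_right (by omega)] at h
    rw [Fintype.card_subtype]
    convert h
  have hcard' : Fintype.card {v // ¬ free v} = p - q := by
    rw [Fintype.card_subtype_compl, hcard, Fintype.card_fin]
  obtain ⟨G, T, hTinj, hT⟩ := exists_injective_family_of_syndetic_sets
    (ι := {v // ¬ free v}) (x := lam / q - 1) hlam hle (by omega)
    (by rw [sub_pos, one_lt_div (by linarith)]; exact hlt)
    (by
      rw [div_sub_one (by linarith), div_le_div_iff₀ (by linarith) (by linarith)]
      nlinarith)
  let S : Set ℕ → Fin p → Set ℕ := fun E v => if h : free v then Set.Ioi 0 else T E ⟨v, h⟩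
  have hSfree : ∀ E v, free v → S E v = Set.Ioi 0 := fun E v h => dif_pos h
  have hSspecial : ∀ E (v : {v // ¬ free v}), S E v = T E v := fun E v => dif_neg v.2
  have hsyn : ∀ E, RunSyndetic free (S E) G := fun E v hv m => by
    rw [hSspecial E ⟨v, hv⟩]
    exact (hT E).2.1 ⟨v, hv⟩ m
  have hzero : ∀ E v, 0 ∉ S E v := fun E v => by
    by_cases h : free v
    · simp [hSfree E v h]
    · rw [hSspecial E ⟨v, h⟩]
      exact (hT E).1 _
  have hb : free ⟨0, by omega⟩ := hq1
  have hv : ¬ free ⟨q, by omega⟩ := lt_irrefl q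
  have hinj : Function.Injective fun E => closure (SGraphCore (HubAdj free) (S E)) := by
    intro E E' h
    refine hTinj (funext fun v => Set.ext fun n => ?_)
    rw [← hSspecial, ← hSspecial]
    cases n with
    | zero => simp [hzero]
    | succ n =>
      rw [← mem_iff_inLanguage (hSfree E) (hsyn E) hb v.2,
        ← mem_iff_inLanguage (hSfree E') (hsyn E') hb v.2,
        ← inLanguage_closure_iff (X := SGraphCore _ (S E)),
        ← inLanguage_closure_iff (X := SGraphCore _ (S E'))]
      exact iff_of_eq (congrArg (fun X => InLanguage X _) h)
  obtain ⟨𝒜, hsub, huncount, hpair⟩ := exists_uncountable_pairwise_not_conjugate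
    (ℱ := Set.range fun E => closure (SGraphCore (HubAdj free) (S E)))
    (fun h => by
      have := h.to_subtype
      have := (Set.rangeFactorization_injective.2 hinj).countable
      obtain ⟨f, hf⟩ := exists_surjective_nat (Set ℕ)
      exact Function.cantor_surjective f hf)
    (by rintro _ ⟨E, rfl⟩; exact isClosed_closure)
    (by rintro _ ⟨E, rfl⟩; exact (translationInvariant_sGraphCore _ _).closure)
  refine ⟨𝒜, huncount, fun X hX => ?_, hpair⟩
  obtain ⟨E, rfl⟩ := hsub hX
  refine ⟨⟨HubAdj free, S E, fun v h => h.1 rfl, fun v => ?_, hzero E, rfl⟩,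
    hasSpecification_of_runSyndetic (hSfree E) (hsyn E) hb hv,
    hasEntropy_of_runSyndetic (hSfree E) (hsyn E) hb hv hlam ?_⟩
  · by_cases h : free v
    · exact ⟨1, by simp [hSfree E v h]⟩
    · obtain ⟨j, -, hj⟩ := hsyn E v h 0
      exact ⟨_, hj⟩
  · simp only [hSspecial, (hT E).2.2, hcard]
    field_simp
    ring
end
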